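/- Fix an integer t ≥ 2 and let W_K(q) = Σ q^{n(T)}, the sum being over all canonical t-ary trees T whose width w(T) is at most K. There is a positive constant c_7 (depending on t) such that for all K ≥ c_7, W_K(q) has a unique singularity q_K with |q_K| ≤ 0.6; it is a simple pole and a zero of det(I − M_K(q)), where M_K(q) is the N(K)×N(K) matrix with entries q^r·[r/t ≤ s ≤ (r+K)/t] and N(K) = ⌈K/(t−1)⌉ − 1. Moreover there exist positive constants c_5, c_6 depending on t such that q_0 + (c_5/K)·q_0^{K/(t−1)} ≤ q_K ≤ q_0 + c_6·K²·q_0^{K/(t−1)}, where q_0 is the dominant singularity of the (unrestricted) tree generating function. -/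

import Mathlib

open scoped BigOperators
open Filter MeasureTheory

noncomputable section

/-- `hp t j = 1 + t + ⋯ + t^(j-1) = (t^j - 1)/(t-1)`. -/
def hp (t j : ℕ) : ℕ := ∑ i ∈ Finset.range j, t ^ i

/-- The series `b(q,u,v,w)`
`b = Σ_{j≥1} v q^{h_j} u^{t^j} w^j/(1−q^{h_j} u^{t^j}) ∏_{i=1}^{j−1} (1−v−q^{h_i}u^{t^i})/(1−q^{h_i}u^{t^i})`. -/
def bGF (t : ℕ) (q u v w : ℂ) : ℂ :=
  ∑' j : ℕ,
    v * q ^ hp t (j + 1) * u ^ t ^ (j + 1) * w ^ (j + 1) /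
        (1 - q ^ hp t (j + 1) * u ^ t ^ (j + 1)) *
      ∏ i ∈ Finset.Icc 1 j,
        (1 - v - q ^ hp t i * u ^ t ^ i) / (1 - q ^ hp t i * u ^ t ^ i)

/-- The series `a(q,u,v,w)` (for canonical forests with `r` roots)
`a = Σ_{j≥0} v q^{r h_j} u^{r t^j} w^j ∏_{i=1}^{j} (1−v−q^{h_i}u^{t^i})/(1−q^{h_i}u^{t^i})`. -/
def aGF (t r : ℕ) (q u v w : ℂ) : ℂ :=
  ∑' j : ℕ,
    v * q ^ (r * hp t j) * u ^ (r * t ^ j) * w ^ j *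
      ∏ i ∈ Finset.Icc 1 j,
        (1 - v - q ^ hp t i * u ^ t ^ i) / (1 - q ^ hp t i * u ^ t ^ i)

/-- A canonical `t`-ary forest with `r` (ordered) roots, encoded by its sequence of
numbers of internal vertices on each level (a canonical forest is uniquely determined
by this sequence: on each level the leaves come first, since outdegrees read from left
to right are non-decreasing).  The number `c_0` of internal vertices on level `0` is at
most `r`, each level's internal-vertex count satisfies `1 ≤ c_{k+1} ≤ t·c_k`, and the
list stops at the last level containing internal vertices. -/
structure CanonicalForest (t r : ℕ) where
  levels : List ℕ
  pos : ∀ c ∈ levels, 0 < c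
  head_le : ∀ c ∈ levels.head?, c ≤ r
  chain : levels.Chain' fun a b => b ≤ t * a

namespace CanonicalForest

variable {t r : ℕ} (T : CanonicalForest t r)

/-- the number `n(T)` of internal vertices -/
def size : ℕ := T.levels.sum

/-- the height `h(T)`: the maximal distance of a leaf from the root level -/
def height : ℕ := T.levels.length

/-- the number of internal vertices at depth `k` -/
def internAt (k : ℕ) : ℕ := T.levels.getD k 0

/-- the number of vertices at depth `k` -/
def vertsAt (k : ℕ) : ℕ := if k = 0 then r else t * T.internAt (k - 1)

/-- the number of leaves at depth `k` -/
def leavesAt (k : ℕ) : ℕ := T.vertsAt k - T.internAt k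

/-- the number `m(T)` of leaves at maximal depth -/
def lastLeaves : ℕ := T.vertsAt T.height

/-- the number `d(T)` of distinct depths at which leaves occur -/
def distinctDepths : ℕ :=
  ((Finset.range (T.height + 1)).filter fun k => 0 < T.leavesAt k).card

/-- the (leaf-)width `w(T)`: the maximal number of leaves on one level -/
def width : ℕ := (Finset.range (T.height + 1)).sup fun k => T.leavesAt k

/-- the total path length `ℓ(T)`: the sum of the depths of all vertices -/
def pathLength : ℕ := ∑ k ∈ Finset.range (T.height + 1), k * T.vertsAt k

end CanonicalForest

/-- the number of canonical `t`-ary forests with `r` roots and `n` internal vertices -/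
def forestCount (t r n : ℕ) : ℕ := Nat.card {T : CanonicalForest t r // T.size = n}

/-- the probability of an event under the uniform distribution on canonical `t`-ary
forests with `r` roots and `n` internal vertices -/
def forestProb (t r n : ℕ) (s : Set (CanonicalForest t r)) : ℝ :=
  (Nat.card {T : CanonicalForest t r // T.size = n ∧ T ∈ s} : ℝ) / forestCount t r n

/-- the expectation of a random variable under the uniform distribution on canonical
`t`-ary forests with `r` roots and `n` internal vertices -/
def forestExp (t r n : ℕ) (f : CanonicalForest t r → ℝ) : ℝ :=
  (∑ᶠ T : {T : CanonicalForest t r // T.size = n}, f T.1) / forestCount t r n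

/-- the variance of a random variable under the uniform distribution on canonical
`t`-ary forests with `r` roots and `n` internal vertices -/
def forestVar (t r n : ℕ) (f : CanonicalForest t r → ℝ) : ℝ :=
  forestExp t r n (fun T => f T ^ 2) - forestExp t r n f ^ 2

/-- the distribution function of the standard normal distribution -/
def stdGaussCDF (x : ℝ) : ℝ :=
  (Real.sqrt (2 * Real.pi))⁻¹ * ∫ u in Set.Iic x, Real.exp (-u ^ 2 / 2)

/-- the density of the standard normal distribution -/
def stdGaussPDF (x : ℝ) : ℝ :=
  (Real.sqrt (2 * Real.pi))⁻¹ * Real.exp (-x ^ 2 / 2)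


/-- `N(K) = ⌈K/(t−1)⌉ − 1` -/
def NK (t K : ℕ) : ℕ := (K + t - 2) / (t - 1) - 1

/-- `det(I − M_K(q))`, where `M_K(q)` is the `N(K)×N(K)` transfer matrix with entries
`q^r·[r/t ≤ s ≤ (r+K)/t]` (rows and columns indexed by `1 ≤ r, s ≤ N(K)`). -/
def detIminusMK (t K : ℕ) (q : ℂ) : ℂ :=
  Matrix.det (Matrix.of fun r s : Fin (NK t K) =>
    (if r = s then (1 : ℂ) else 0)
      - q ^ ((r : ℕ) + 1) *
        (if (r : ℕ) + 1 ≤ t * ((s : ℕ) + 1) ∧ t * ((s : ℕ) + 1) ≤ (r : ℕ) + 1 + K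
          then 1 else 0))

/-! ### Part A : the unrestricted left eigenvector -/

lemma hp_succ (t j : ℕ) : hp t (j + 1) = t * hp t j + 1 := by
  unfold hp
  rw [Finset.sum_range_succ', Finset.mul_sum]
  simp [pow_succ, mul_comm]

lemma hp_zero (t : ℕ) : hp t 0 = 0 := by simp [hp]

lemma hp_one (t : ℕ) : hp t 1 = 1 := by simp [hp]

lemma hp_pos (t j : ℕ) : 1 ≤ hp t (j + 1) := by rw [hp_succ]; omega

lemma hp_ge3 (t j : ℕ) (ht : 2 ≤ t) : 3 ≤ hp t (j + 2) := by
  rw [hp_succ]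
  have := hp_pos t j
  nlinarith

lemma hp_ge7 (t j : ℕ) (ht : 2 ≤ t) : 7 ≤ hp t (j + 3) := by
  rw [hp_succ]
  have := hp_ge3 t j ht
  nlinarith

def yy (t : ℕ) (q : ℂ) (i : ℕ) : ℂ := q ^ hp t (i + 1) / (1 - q ^ hp t (i + 1))

def YY (t : ℕ) (q : ℂ) (j : ℕ) : ℂ := ∏ i ∈ Finset.range j, (-(yy t q i))

def ph (t : ℕ) (q : ℂ) (s : ℕ) : ℂ := ∑' j : ℕ, YY t q j * q ^ (t * hp t j * s)

lemma YY_zero (t : ℕ) (q : ℂ) : YY t q 0 = 1 := by simp [YY]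

lemma YY_succ (t : ℕ) (q : ℂ) (j : ℕ) : YY t q (j + 1) = YY t q j * (-(yy t q j)) := by
  simp [YY, Finset.prod_range_succ]

lemma norm_pow_le_rn {q : ℂ} {r : ℝ} (hq : ‖q‖ ≤ r) (hr : r ≤ 1) {n h : ℕ} (hn : n ≤ h) :
    ‖q ^ h‖ ≤ r ^ n := by
  rw [norm_pow]
  have h0 : (0 : ℝ) ≤ r := (norm_nonneg q).trans hq
  calc ‖q‖ ^ h ≤ r ^ h := by gcongr
    _ ≤ r ^ n := pow_le_pow_of_le_one h0 hr hn

lemma norm_one_sub_ge {q : ℂ} {r : ℝ} (hq : ‖q‖ ≤ r) (hr : r ≤ 1) {n h : ℕ} (hn : n ≤ h) :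
    1 - r ^ n ≤ ‖1 - q ^ h‖ := by
  have h1 := norm_pow_le_rn hq hr hn
  have h2 := norm_sub_norm_le (1 : ℂ) (q ^ h)
  rw [norm_one] at h2
  linarith

lemma one_sub_pow_ne {q : ℂ} (hq : ‖q‖ < 1) {h : ℕ} (hh : 1 ≤ h) : (1 - q ^ h) ≠ 0 := by
  have := norm_one_sub_ge (le_refl ‖q‖) hq.le hh
  intro h0
  rw [h0, norm_zero] at this
  simp at this
  linarith

lemma norm_yy_le {t : ℕ} {q : ℂ} {r : ℝ} (hq : ‖q‖ ≤ r) (hr : r < 1) {n i : ℕ} (h1 : 1 ≤ n)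
    (hn : n ≤ hp t (i + 1)) : ‖yy t q i‖ ≤ r ^ n / (1 - r ^ n) := by
  unfold yy
  rw [norm_div]
  have h0 : (0 : ℝ) ≤ r := (norm_nonneg q).trans hq
  have h2 : r ^ n < 1 := pow_lt_one₀ h0 hr (by omega)
  have := norm_pow_le_rn hq hr.le hn
  have := norm_one_sub_ge hq hr.le hn
  exact div_le_div₀ (by positivity) (by assumption) (by linarith) (by assumption)

lemma norm_yy0 {t : ℕ} {q : ℂ} (hq : ‖q‖ ≤ 0.61) : ‖yy t q 0‖ ≤ 1.6 := by
  refine (norm_yy_le hq (by norm_num) le_rfl (hp_pos t 0)).trans (by norm_num)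

lemma norm_yy0' {t : ℕ} {q : ℂ} (hq : ‖q‖ ≤ 0.6) : ‖yy t q 0‖ ≤ 1.5 := by
  refine (norm_yy_le hq (by norm_num) le_rfl (hp_pos t 0)).trans (by norm_num)

lemma norm_yy1 {t : ℕ} (ht : 2 ≤ t) {q : ℂ} (hq : ‖q‖ ≤ 0.61) (i : ℕ) :
    ‖yy t q (i + 1)‖ ≤ 0.3 := by
  refine (norm_yy_le hq (by norm_num) (by norm_num) (hp_ge3 t i ht)).trans (by norm_num)

lemma norm_yy1' {t : ℕ} (ht : 2 ≤ t) {q : ℂ} (hq : ‖q‖ ≤ 0.6) (i : ℕ) :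
    ‖yy t q (i + 1)‖ ≤ 0.28 := by
  refine (norm_yy_le hq (by norm_num) (by norm_num) (hp_ge3 t i ht)).trans (by norm_num)

lemma norm_yy2 {t : ℕ} (ht : 2 ≤ t) {q : ℂ} (hq : ‖q‖ ≤ 0.61) (i : ℕ) :
    ‖yy t q (i + 2)‖ ≤ 0.05 := by
  refine (norm_yy_le hq (by norm_num) (by norm_num) (hp_ge7 t i ht)).trans (by norm_num)

lemma norm_YY_succ {t : ℕ} (ht : 2 ≤ t) {q : ℂ} (hq : ‖q‖ ≤ 0.61) (j : ℕ) :
    ‖YY t q (j + 1)‖ ≤ ‖yy t q 0‖ * 0.3 ^ j := by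
  induction j with
  | zero => simp [YY_succ, YY_zero]
  | succ j ih =>
    rw [YY_succ, norm_mul, norm_neg, pow_succ, ← mul_assoc]
    have := norm_yy1 ht hq j
    gcongr

lemma norm_YY_succ2 {t : ℕ} (ht : 2 ≤ t) {q : ℂ} (hq : ‖q‖ ≤ 0.61) (j : ℕ) :
    ‖YY t q (j + 2)‖ ≤ ‖yy t q 0‖ * ‖yy t q 1‖ * 0.05 ^ j := by
  induction j with
  | zero => simp [YY_succ, YY_zero]
  | succ j ih =>
    rw [YY_succ, norm_mul, norm_neg, pow_succ, ← mul_assoc]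
    have := norm_yy2 ht hq j
    gcongr

lemma norm_YY {t : ℕ} (ht : 2 ≤ t) {q : ℂ} (hq : ‖q‖ ≤ 0.61) (j : ℕ) :
    ‖YY t q j‖ ≤ 6 * 0.3 ^ j := by
  cases j with
  | zero => simp [YY_zero]
  | succ j =>
    have h1 := norm_YY_succ ht hq j
    have h2 := norm_yy0 (t := t) hq
    have h3 : (0 : ℝ) < 0.3 ^ j := by positivity
    rw [pow_succ]
    nlinarith

lemma summable_geo6 : Summable (fun j : ℕ => 6 * (0.3 : ℝ) ^ j) :=
  (summable_geometric_of_lt_one (by norm_num) (by norm_num)).mul_left 6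

lemma norm_ph_term {t : ℕ} (ht : 2 ≤ t) {q : ℂ} (hq : ‖q‖ ≤ 0.61) (s j : ℕ) :
    ‖YY t q j * q ^ (t * hp t j * s)‖ ≤ 6 * 0.3 ^ j := by
  rw [norm_mul]
  have h1 := norm_YY ht hq j
  have h2 : ‖q ^ (t * hp t j * s)‖ ≤ 1 := by
    simpa using norm_pow_le_rn (hq.trans (by norm_num : (0.61 : ℝ) ≤ 1)) le_rfl
      (Nat.zero_le (t * hp t j * s))
  calc ‖YY t q j‖ * ‖q ^ (t * hp t j * s)‖ ≤ (6 * (0.3 : ℝ) ^ j) * 1 := by gcongr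
    _ = _ := mul_one _

lemma summable_ph {t : ℕ} (ht : 2 ≤ t) {q : ℂ} (hq : ‖q‖ ≤ 0.61) (s : ℕ) :
    Summable (fun j => YY t q j * q ^ (t * hp t j * s)) :=
  Summable.of_norm_bounded summable_geo6 (norm_ph_term ht hq s)

lemma norm_ph {t : ℕ} (ht : 2 ≤ t) {q : ℂ} (hq : ‖q‖ ≤ 0.61) (s : ℕ) : ‖ph t q s‖ ≤ 9 := by
  unfold ph
  refine (tsum_of_norm_bounded (summable_geo6.hasSum) (norm_ph_term ht hq s)).trans ?_
  rw [tsum_mul_left, tsum_geometric_of_lt_one (by norm_num) (by norm_num)]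
  norm_num

lemma ph_eq_one_add {t : ℕ} (ht : 2 ≤ t) {q : ℂ} (hq : ‖q‖ ≤ 0.61) (s : ℕ) :
    ph t q s = 1 + ∑' j : ℕ, YY t q (j + 1) * q ^ (t * hp t (j + 1) * s) := by
  unfold ph
  rw [(summable_ph ht hq s).tsum_eq_zero_add]
  simp [YY_zero, hp_zero]

lemma norm_ph_sub_one {t : ℕ} (ht : 2 ≤ t) {q : ℂ} (hq : ‖q‖ ≤ 0.6) (s : ℕ) (hs : 1 ≤ s) :
    ‖ph t q s - 1‖ ≤ 0.78 := by
  have hq' : ‖q‖ ≤ 0.61 := hq.trans (by norm_num)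
  rw [ph_eq_one_add ht hq' s, add_sub_cancel_left]
  have hsum : Summable (fun j : ℕ => 0.54 * (0.3 : ℝ) ^ j) :=
    (summable_geometric_of_lt_one (by norm_num) (by norm_num)).mul_left _
  refine (tsum_of_norm_bounded hsum.hasSum (fun j => ?_)).trans ?_
  · rw [norm_mul]
    have h1 := norm_YY_succ ht hq' j
    have h2 := norm_yy0' (t := t) hq
    have h3 : ‖q ^ (t * hp t (j + 1) * s)‖ ≤ 0.6 ^ 2 := by
      apply norm_pow_le_rn hq (by norm_num)
      have := hp_pos t j
      have h4 : 2 * 1 ≤ t * hp t (j + 1) := Nat.mul_le_mul ht this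
      nlinarith
    calc _ ≤ (1.5 * 0.3 ^ j) * (0.6 ^ 2 : ℝ) := by
          gcongr
          exact h1.trans (by gcongr)
      _ = _ := by ring
  · rw [tsum_mul_left, tsum_geometric_of_lt_one (by norm_num) (by norm_num)]
    norm_num

/-- the functional equation of `ph` -/
lemma ph_rec {t : ℕ} (ht : 2 ≤ t) {q : ℂ} (hq : ‖q‖ ≤ 0.61) (s : ℕ) :
    HasSum (fun k : ℕ => ph t q (t * s + k + 1) * q ^ (t * s + k + 1)) (1 - ph t q s) := by
  have hq1 : ‖q‖ < 1 := hq.trans_lt (by norm_num)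
  set f : ℕ × ℕ → ℂ := fun p =>
    YY t q p.1 * q ^ (t * hp t p.1 * (t * s + p.2 + 1)) * q ^ (t * s + p.2 + 1) with hf
  have hfs : Summable f := by
    have hs : Summable (fun p : ℕ × ℕ => (6 * (0.3 : ℝ) ^ p.1) * (0.61 : ℝ) ^ p.2) :=
      Summable.mul_of_nonneg summable_geo6
        (summable_geometric_of_lt_one (by norm_num) (by norm_num))
        (fun j => by positivity) (fun j => by positivity)
    refine Summable.of_norm_bounded hs (fun p => ?_)
    rw [hf, norm_mul]
    have h1 := norm_ph_term ht hq (t * s + p.2 + 1) p.1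
    have h2 : ‖q ^ (t * s + p.2 + 1)‖ ≤ 0.61 ^ p.2 :=
      norm_pow_le_rn hq (by norm_num) (by omega)
    gcongr
  have hterm : ∀ j, HasSum (fun k => f (j, k)) (-(YY t q (j + 1) * q ^ (t * hp t (j + 1) * s))) := by
    intro j
    have hz : ‖q ^ hp t (j + 1)‖ < 1 := by
      rw [norm_pow]
      exact pow_lt_one₀ (norm_nonneg _) hq1 (by have := hp_pos t j; omega)
    have hg := (hasSum_geometric_of_norm_lt_one hz).mul_left
      (YY t q j * q ^ (hp t (j + 1) * (t * s + 1)))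
    have e1 : (fun k => f (j, k)) =
        fun k => YY t q j * q ^ (hp t (j + 1) * (t * s + 1)) * (q ^ hp t (j + 1)) ^ k := by
      funext k
      simp only [hf]
      rw [← pow_mul, mul_assoc (YY t q j), mul_assoc (YY t q j), ← pow_add, ← pow_add, hp_succ]
      congr 2
      ring
    rw [e1]
    have hne := one_sub_pow_ne hq1 (hp_pos t j)
    have e2 : -(YY t q (j + 1) * q ^ (t * hp t (j + 1) * s)) =
        YY t q j * q ^ (hp t (j + 1) * (t * s + 1)) * (1 - q ^ hp t (j + 1))⁻¹ := by
      rw [YY_succ, yy]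
      field_simp
      ring
    rw [e2]
    exact hg
  have hswap : HasSum (fun k => ∑' j, f (j, k)) (∑' p : ℕ × ℕ, f p) := by
    have h2 := (Equiv.prodComm ℕ ℕ).hasSum_iff.mpr hfs.hasSum
    exact h2.prod_fiberwise (fun k => (h2.summable.prod_factor k).hasSum)
  have hsum1 : (∑' p : ℕ × ℕ, f p) = 1 - ph t q s := by
    have := (hfs.hasSum.prod_fiberwise hterm).tsum_eq
    rw [← this, ph_eq_one_add ht hq s, tsum_neg]
    ring
  rw [hsum1] at hswap
  convert hswap using 2 with k
  simp only [hf, ph]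
  rw [tsum_mul_right]

lemma bGF_eq {t : ℕ} (ht : 2 ≤ t) {q : ℂ} (hq : ‖q‖ ≤ 0.61) : bGF t q 1 1 1 = 1 - ph t q 0 := by
  rw [ph_eq_one_add ht hq 0, bGF, ← neg_inj, ← tsum_neg]
  rw [neg_sub, add_sub_cancel_left]
  congr 1
  funext j
  rw [YY_succ, YY, yy]
  have : ∏ i ∈ Finset.Icc 1 j, (1 - 1 - q ^ hp t i * 1 ^ t ^ i) / (1 - q ^ hp t i * 1 ^ t ^ i)
      = ∏ i ∈ Finset.range j, (-(yy t q i)) := by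
    clear hq
    induction j with
    | zero => simp
    | succ j ih =>
      rw [Finset.prod_Icc_succ_top (by omega), ih, Finset.prod_range_succ, yy]
      simp [neg_div]
  rw [this]
  simp
  ring

/-! ### Part B : the function `1 - b` -/

lemma ph_zero_eq (t : ℕ) (q : ℂ) : ph t q 0 = ∑' j, YY t q j := by simp [ph]

lemma differentiableAt_yy (t i : ℕ) {q : ℂ} (hq : ‖q‖ < 1) :
    DifferentiableAt ℂ (fun q => yy t q i) q := by
  unfold yy
  have := one_sub_pow_ne hq (hp_pos t i)
  fun_prop (disch := assumption)

lemma differentiableAt_YY (t j : ℕ) {q : ℂ} (hq : ‖q‖ < 1) :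
    DifferentiableAt ℂ (fun q => YY t q j) q := by
  induction j with
  | zero => simp [YY_zero]
  | succ j ih =>
    have h := ih.mul (differentiableAt_yy t j hq).neg
    have e : (fun q => YY t q (j + 1)) = (fun q => YY t q j) * (-fun q => yy t q j) := by
      funext q; simp [YY_succ]
    rw [e]; exact h

lemma deriv_YY_succ (t j : ℕ) {q : ℂ} (hq : ‖q‖ < 1) :
    deriv (fun q => YY t q (j + 1)) q =
      - (deriv (fun q => YY t q j) q * yy t q j + YY t q j * deriv (fun q => yy t q j) q) := by
  have h := ((differentiableAt_YY t j hq).hasDerivAt.mul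
    (differentiableAt_yy t j hq).hasDerivAt.neg).deriv
  have e : (fun q => YY t q (j + 1)) = (fun q => YY t q j) * (-fun q => yy t q j) := by
    funext q; simp [YY_succ]
  rw [e, h]
  simp
  ring

lemma deriv_yy (t i : ℕ) {q : ℂ} (hq : ‖q‖ < 1) :
    deriv (fun q => yy t q i) q =
      hp t (i + 1) * q ^ (hp t (i + 1) - 1) / (1 - q ^ hp t (i + 1)) ^ 2 := by
  have hne := one_sub_pow_ne hq (hp_pos t i)
  have h1 := hasDerivAt_pow (hp t (i + 1)) q
  have h2 := h1.div (h1.const_sub 1) hne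
  have h3 := h2.deriv
  unfold yy
  refine Eq.trans h3 ?_
  congr 1
  ring

lemma differentiableOn_ph0 {t : ℕ} (ht : 2 ≤ t) :
    DifferentiableOn ℂ (fun q => ph t q 0) (Metric.ball 0 0.61) := by
  simp_rw [ph_zero_eq]
  refine Complex.differentiableOn_tsum_of_summable_norm summable_geo6 (fun j q hq => ?_)
    Metric.isOpen_ball (fun j q hq => ?_)
  · rw [mem_ball_zero_iff] at hq
    exact (differentiableAt_YY t j (hq.trans (by norm_num))).differentiableWithinAt
  · rw [mem_ball_zero_iff] at hq
    exact norm_YY ht hq.le j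

lemma hasSum_deriv_ph0 {t : ℕ} (ht : 2 ≤ t) {q : ℂ} (hq : ‖q‖ < 0.61) :
    HasSum (fun j => deriv (fun q => YY t q j) q) (deriv (fun q => ph t q 0) q) := by
  simp_rw [ph_zero_eq]
  refine Complex.hasSum_deriv_of_summable_norm (U := Metric.ball 0 0.61) summable_geo6
    (fun j q hq => ?_)
    Metric.isOpen_ball (fun j q hq => ?_) (by simpa using hq)
  · rw [mem_ball_zero_iff] at hq
    exact (differentiableAt_YY t j (hq.trans (by norm_num))).differentiableWithinAt
  · rw [mem_ball_zero_iff] at hq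
    exact norm_YY ht hq.le j

lemma conj_YY (t j : ℕ) (x : ℝ) : (starRingEnd ℂ) (YY t x j) = YY t x j := by
  simp [YY, yy]

lemma conj_ph (t s : ℕ) (x : ℝ) : (starRingEnd ℂ) (ph t x s) = ph t x s := by
  unfold ph
  rw [Complex.conj_tsum]
  simp [conj_YY]

lemma ph_re (t s : ℕ) (x : ℝ) : ((ph t x s).re : ℂ) = ph t x s :=
  Complex.conj_eq_iff_re.mp (conj_ph t s x)

lemma mul_pow_le (m : ℕ) (hm : 2 ≤ m) (n : ℕ) (hn : m ≤ n) :
    (n : ℝ) * 0.6 ^ n ≤ m * 0.6 ^ m := by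
  induction n, hn using Nat.le_induction with
  | base => exact le_rfl
  | succ n hn ih =>
    refine le_trans ?_ ih
    have h1 : (2 : ℝ) ≤ n := by exact_mod_cast hm.trans hn
    have h2 : (0 : ℝ) < 0.6 ^ n := by positivity
    push_cast
    rw [pow_succ]
    nlinarith

lemma norm_deriv_yy {t i : ℕ} {x : ℝ} (h0 : 1 / 2 ≤ x) (h1 : x ≤ 0.6) {m : ℕ} (hm : 2 ≤ m)
    (hmh : m ≤ hp t (i + 1)) :
    ‖deriv (fun q => yy t q i) (x : ℂ)‖ * x ≤ m * 0.6 ^ m / (1 - 0.6 ^ m) ^ 2 := by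
  have hx : ‖(x : ℂ)‖ = x := by simp; linarith
  have hx1 : ‖(x : ℂ)‖ < 1 := by rw [hx]; linarith
  have hx06 : ‖(x : ℂ)‖ ≤ 0.6 := by rw [hx]; linarith
  rw [deriv_yy t i hx1, norm_div, norm_mul, norm_pow, norm_pow, hx]
  have h2 := norm_one_sub_ge hx06 (by norm_num) hmh
  have h3 : (0 : ℝ) < 1 - 0.6 ^ m := by
    have : (0.6 : ℝ) ^ m < 1 := pow_lt_one₀ (by norm_num) (by norm_num) (by omega)
    linarith
  have h4 : ‖((hp t (i + 1) : ℕ) : ℂ)‖ = (hp t (i + 1) : ℝ) := by simp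
  rw [h4, div_mul_eq_mul_div, mul_assoc, ← pow_succ]
  have h5 : hp t (i + 1) - 1 + 1 = hp t (i + 1) := by have := hp_pos t i; omega
  rw [h5]
  have h6 : (hp t (i + 1) : ℝ) * x ^ hp t (i + 1) ≤ m * 0.6 ^ m := by
    refine le_trans ?_ (mul_pow_le m hm _ hmh)
    have : (0 : ℝ) ≤ x := by linarith
    gcongr
  exact div_le_div₀ (by positivity) h6 (by positivity) (by gcongr)

lemma deriv_ph0_ne {t : ℕ} (ht : 2 ≤ t) {x : ℝ} (h0 : 1 / 2 ≤ x) (h1 : x ≤ 0.6) :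
    deriv (fun q => ph t q 0) (x : ℂ) ≠ 0 := by
  have hx : ‖(x : ℂ)‖ = x := by simp; linarith
  have hx1 : ‖(x : ℂ)‖ < 1 := by rw [hx]; linarith
  have hx06 : ‖(x : ℂ)‖ ≤ 0.6 := by rw [hx]; linarith
  have hx061 : ‖(x : ℂ)‖ ≤ 0.61 := by rw [hx]; linarith
  have hs := hasSum_deriv_ph0 ht (q := x) (by rw [hx]; linarith)
  intro hz
  rw [hz] at hs
  set D : ℝ := 1 / (1 - x) ^ 2 with hD
  have hDpos : 0 < D := by rw [hD]; have : 0 < 1 - x := by linarith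
                           positivity
  have hne : (1 - (x : ℂ)) ≠ 0 := by
    have := one_sub_pow_ne hx1 (le_refl 1); simpa using this
  have hnorm1x : ‖1 - (x : ℂ)‖ = 1 - x := by
    rw [← Complex.ofReal_one, ← Complex.ofReal_sub, Complex.norm_real, Real.norm_eq_abs,
      abs_of_pos (by linarith)]
  have hd0 : deriv (fun q => YY t q 0) (x : ℂ) = 0 := by simp [YY_zero]
  have hd1 : ‖deriv (fun q => YY t q 1) (x : ℂ)‖ = D := by
    rw [deriv_YY_succ t 0 hx1, hd0, YY_zero, deriv_yy t 0 hx1]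
    simp [hp_one, hnorm1x, hD]
  have ha1 : ‖YY t x 1‖ = x * ((1 - x) * D) := by
    rw [YY_succ, YY_zero, yy]
    simp [hp_one, hnorm1x, hD]
    have : 1 - x ≠ 0 := by linarith
    rw [abs_of_pos (by linarith)]
    field_simp
  have hd2 : ‖deriv (fun q => YY t q 2) (x : ℂ)‖ ≤ 0.81 * D := by
    rw [deriv_YY_succ t 1 hx1, norm_neg]
    refine (norm_add_le _ _).trans ?_
    rw [norm_mul, norm_mul, hd1, ha1]
    have e1 := norm_yy1' ht hx06 0
    have e2 := norm_deriv_yy (t := t) (i := 1) h0 h1 (m := 3) (by norm_num) (hp_ge3 t 0 ht)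
    have e3 : (1 - x) * D * (‖deriv (fun q => yy t q 1) (x : ℂ)‖ * x) ≤
        (1 / 2 * D) * (3 * 0.6 ^ 3 / (1 - 0.6 ^ 3) ^ 2) := by
      have : 1 - x ≤ 1 / 2 := by linarith
      push_cast at e2
      gcongr
    have e4 : D * ‖yy t x 1‖ ≤ D * 0.28 := by gcongr
    have e5 : (3 * 0.6 ^ 3 / (1 - 0.6 ^ 3) ^ 2 : ℝ) ≤ 1.06 := by norm_num
    nlinarith
  have ha2 : ‖YY t x 2‖ ≤ 0.07 * D := by
    rw [YY_succ, norm_mul, norm_neg, ha1]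
    have e1 := norm_yy1' ht hx06 0
    have e2 : x * (1 - x) ≤ 1 / 4 := by nlinarith [sq_nonneg (x - 1 / 2)]
    calc x * ((1 - x) * D) * ‖yy t x 1‖ = (x * (1 - x)) * D * ‖yy t x 1‖ := by ring
      _ ≤ 1 / 4 * D * 0.28 := by gcongr
      _ = _ := by ring
  have hind : ∀ j, ‖deriv (fun q => YY t q (j + 2)) (x : ℂ)‖ ≤ 0.81 * D * 0.1 ^ j ∧
      ‖YY t x (j + 2)‖ ≤ 0.07 * D * 0.1 ^ j := by
    intro j
    induction j with
    | zero => simpa using ⟨hd2, ha2⟩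
    | succ j ih =>
      obtain ⟨i1, i2⟩ := ih
      have e1 := norm_yy2 ht hx061 j
      have e2 := norm_deriv_yy (t := t) (i := j + 2) h0 h1 (m := 7) (by norm_num) (hp_ge7 t j ht)
      have e3 : ‖deriv (fun q => yy t q (j + 2)) (x : ℂ)‖ ≤ 0.42 := by
        have e5 : ((7 : ℕ) * 0.6 ^ 7 / (1 - 0.6 ^ 7) ^ 2 : ℝ) ≤ 0.21 := by norm_num
        nlinarith [norm_nonneg (deriv (fun q => yy t q (j + 2)) (x : ℂ))]
      have hp0 : 0 < D * 0.1 ^ j := by positivity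
      constructor
      · rw [deriv_YY_succ t (j + 2) hx1, norm_neg]
        refine (norm_add_le _ _).trans ?_
        rw [norm_mul, norm_mul]
        calc _ ≤ (0.81 * D * 0.1 ^ j) * 0.05 + (0.07 * D * 0.1 ^ j) * (0.42 : ℝ) := by gcongr
          _ ≤ _ := by rw [pow_succ]; nlinarith
      · rw [YY_succ, norm_mul, norm_neg]
        calc _ ≤ (0.07 * D * 0.1 ^ j) * (0.05 : ℝ) := by gcongr
          _ ≤ _ := by rw [pow_succ]; nlinarith
  have hs2 := (hasSum_nat_add_iff' (f := fun j => deriv (fun q => YY t q j) (x : ℂ)) 2).mpr hs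
  simp only [Finset.sum_range_succ, Finset.sum_range_zero, hd0] at hs2
  have hgs : HasSum (fun j : ℕ => 0.81 * D * (0.1 : ℝ) ^ j) (0.81 * D * (1 - 0.1)⁻¹) :=
    (hasSum_geometric_of_lt_one (by norm_num) (by norm_num)).mul_left _
  have hb := tsum_of_norm_bounded hgs (fun j => (hind j).1)
  rw [hs2.tsum_eq] at hb
  simp only [zero_add, zero_sub, norm_neg, hd1] at hb
  norm_num at hb
  linarith

lemma ph0_half {t : ℕ} (ht : 2 ≤ t) : 0 < (ph t ((1 / 2 : ℝ) : ℂ) 0).re := by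
  set q : ℂ := ((1 / 2 : ℝ) : ℂ) with hq
  have hqn : ‖q‖ ≤ 0.61 := by rw [hq, Complex.norm_real]; norm_num
  have hs : HasSum (fun j => YY t q j) (ph t q 0) := by
    have := (summable_ph ht hqn 0).hasSum
    simpa [ph] using this
  have hs3 := (hasSum_nat_add_iff' 3).mpr hs
  have hy0 : yy t q 0 = 1 := by simp [yy, hp_one, hq]; norm_num
  have hgs : HasSum (fun j : ℕ => ‖yy t q 1‖ * 0.05 * (0.05 : ℝ) ^ j)
      (‖yy t q 1‖ * 0.05 * (1 - 0.05)⁻¹) :=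
    (hasSum_geometric_of_lt_one (by norm_num) (by norm_num)).mul_left _
  have hb := tsum_of_norm_bounded (f := fun j => YY t q (j + 3)) hgs (fun j => by
    have := norm_YY_succ2 ht hqn (j + 1)
    rw [hy0, norm_one, one_mul, pow_succ] at this
    have h2 : j + 1 + 2 = j + 3 := by ring
    rw [h2] at this
    linarith)
  rw [hs3.tsum_eq] at hb
  simp only [Finset.sum_range_succ, Finset.sum_range_zero, YY_succ, YY_zero, hy0] at hb
  have hy1 : yy t q 1 = (((1 / 2 : ℝ) ^ hp t 2 / (1 - (1 / 2 : ℝ) ^ hp t 2) : ℝ) : ℂ) := by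
    simp [yy, hq]
  set y : ℝ := (1 / 2 : ℝ) ^ hp t 2 / (1 - (1 / 2 : ℝ) ^ hp t 2) with hy
  have hypos : 0 < y := by
    have : (1 / 2 : ℝ) ^ hp t 2 < 1 := pow_lt_one₀ (by norm_num) (by norm_num) (by
      have h := hp_pos t 1; exact Nat.one_le_iff_ne_zero.mp h)
    rw [hy]
    have : 0 < 1 - (1 / 2 : ℝ) ^ hp t 2 := by linarith
    positivity
  rw [hy1, Complex.norm_real, Real.norm_eq_abs, abs_of_pos hypos] at hb
  have h3 := (Complex.abs_re_le_norm _).trans hb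
  simp at h3
  rw [abs_le] at h3
  norm_num at h3
  linarith

lemma ph0_06 {t : ℕ} (ht : 2 ≤ t) : (ph t ((0.6 : ℝ) : ℂ) 0).re < 0 := by
  set q : ℂ := ((0.6 : ℝ) : ℂ) with hq
  have hqn' : ‖q‖ ≤ 0.6 := by rw [hq, Complex.norm_real]; norm_num
  have hqn : ‖q‖ ≤ 0.61 := by rw [hq, Complex.norm_real]; norm_num
  have hs : HasSum (fun j => YY t q j) (ph t q 0) := by
    have := (summable_ph ht hqn 0).hasSum
    simpa [ph] using this
  have hs3 := (hasSum_nat_add_iff' 2).mpr hs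
  have hy0 : yy t q 0 = ((1.5 : ℝ) : ℂ) := by simp [yy, hp_one, hq]; norm_num
  have hgs : HasSum (fun j : ℕ => 0.42 * (0.05 : ℝ) ^ j)
      (0.42 * (1 - 0.05)⁻¹) :=
    (hasSum_geometric_of_lt_one (by norm_num) (by norm_num)).mul_left _
  have hb := tsum_of_norm_bounded (f := fun j => YY t q (j + 2)) hgs (fun j => by
    have h1 := norm_YY_succ2 ht hqn j
    have h2 := norm_yy0' (t := t) hqn'
    have h3 := norm_yy1' ht hqn' 0
    refine h1.trans ?_
    have : ‖yy t q 0‖ * ‖yy t q 1‖ ≤ 1.5 * 0.28 := by gcongr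
    have h4 : (0 : ℝ) < 0.05 ^ j := by positivity
    norm_num at this ⊢
    nlinarith)
  rw [hs3.tsum_eq] at hb
  simp only [Finset.sum_range_succ, Finset.sum_range_zero, YY_succ, YY_zero, hy0] at hb
  have h3 := (Complex.abs_re_le_norm _).trans hb
  simp at h3
  rw [abs_le] at h3
  norm_num at h3
  linarith

lemma q0_mem {t : ℕ} (ht : 2 ≤ t) (q₀ : ℝ)
    (hq₀uniq : ∀ q : ℂ, ‖q‖ < 1 - 0.72 / t → bGF t q 1 1 1 = 1 → q = (q₀ : ℂ)) :
    1 / 2 < q₀ ∧ q₀ < 0.6 := by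
  have hcont : ContinuousOn (fun x : ℝ => (ph t (x : ℂ) 0).re) (Set.Icc (1 / 2) 0.6) := by
    refine Complex.continuous_re.comp_continuousOn ?_
    refine (differentiableOn_ph0 ht).continuousOn.comp Complex.continuous_ofReal.continuousOn ?_
    intro x hx
    simp only [Set.mem_Icc] at hx
    rw [mem_ball_zero_iff, Complex.norm_real, Real.norm_eq_abs, abs_of_pos (by linarith)]
    linarith
  have hiv := intermediate_value_Ioo' (by norm_num) hcont
  obtain ⟨x, hx, hx0⟩ := hiv ⟨ph0_06 ht, ph0_half ht⟩
  simp only at hx0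
  have hxn : ‖(x : ℂ)‖ < 0.6 := by
    rw [Complex.norm_real, Real.norm_eq_abs, abs_of_pos (by linarith [hx.1])]
    exact hx.2
  have ht' : (0.72 : ℝ) / t ≤ 0.36 := by
    rw [div_le_iff₀ (by positivity)]
    have : (2 : ℝ) ≤ t := by exact_mod_cast ht
    linarith
  have h1 := hq₀uniq x (by linarith) (by
    rw [bGF_eq ht (by linarith), ← ph_re, hx0]; simp)
  have : x = q₀ := by exact_mod_cast h1
  rw [← this]
  exact hx

/-! ### Part C : perturbation of a simple zero -/

lemma perturb_zero {F : ℂ → ℂ} {Fn : ℕ → ℂ → ℂ} {R r q0 : ℝ} (hrR : r < R) (hq0 : 0 < q0)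
    (hq0r : q0 < r)
    (hF : DifferentiableOn ℂ F (Metric.ball 0 R))
    (hFn : ∀ᶠ n in atTop, DifferentiableOn ℂ (Fn n) (Metric.ball 0 R))
    (hunif : ∀ η > 0, ∀ᶠ n in atTop, ∀ q : ℂ, ‖q‖ < R → ‖Fn n q - F q‖ ≤ η)
    (hreal : ∀ᶠ n in atTop, ∀ x : ℝ, |x| < R → (Fn n x).im = 0)
    (h0 : F q0 = 0) (huniq : ∀ q : ℂ, ‖q‖ < R → F q = 0 → q = q0) (hd : deriv F q0 ≠ 0)
    (δ : ℝ) (hδ : 0 < δ) :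
    ∀ᶠ n in atTop, ∃ x : ℝ, |x - q0| ≤ δ ∧ Fn n x = 0 ∧ deriv (Fn n) x ≠ 0 ∧
      ∀ q : ℂ, ‖q‖ ≤ r → Fn n q = 0 → q = x := by
  set c := deriv F q0 with hc
  have hcpos : 0 < ‖c‖ := norm_pos_iff.mpr hd
  have hq0R : ((q0 : ℝ) : ℂ) ∈ Metric.ball (0 : ℂ) R := by
    rw [mem_ball_zero_iff, Complex.norm_real, Real.norm_eq_abs, abs_of_pos hq0]; linarith
  -- the small ball
  have hcont : ContinuousAt (deriv F) q0 := by
    have h1 := hF.analyticOnNhd Metric.isOpen_ball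
    exact (h1.deriv _ hq0R).continuousAt
  obtain ⟨δ1, hδ1, hδ1c⟩ := Metric.continuousAt_iff.mp hcont (‖c‖ / 8) (by positivity)
  obtain ⟨d, hdpos, hdδ, hdδ1, hdr⟩ : ∃ d : ℝ, 0 < d ∧ d ≤ δ ∧ 2 * d ≤ δ1 ∧ q0 + 2 * d ≤ r := by
    refine ⟨min δ (min (δ1 / 2) ((r - q0) / 2)), ?_, min_le_left _ _, ?_, ?_⟩
    · have : 0 < (r - q0) / 2 := by linarith
      positivity
    · have := (min_le_right δ (min (δ1 / 2) ((r - q0) / 2))).trans (min_le_left _ _); linarith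
    · have := (min_le_right δ (min (δ1 / 2) ((r - q0) / 2))).trans (min_le_right _ _); linarith
  have hsub : ∀ z : ℂ, ‖z - q0‖ ≤ 2 * d → ‖z‖ ≤ r := by
    intro z hz
    have := norm_add_le (z - q0) q0
    rw [sub_add_cancel, Complex.norm_real, Real.norm_eq_abs, abs_of_pos hq0] at this
    linarith
  have hFd : ∀ z : ℂ, ‖z‖ ≤ r → DifferentiableAt ℂ F z := fun z hz =>
    hF.differentiableAt (Metric.isOpen_ball.mem_nhds (by rw [mem_ball_zero_iff]; linarith))
  -- lower bound off the small ball
  obtain ⟨m, hm, hmF⟩ : ∃ m : ℝ, 0 < m ∧ ∀ q : ℂ, ‖q‖ ≤ r → d ≤ ‖q - q0‖ → m ≤ ‖F q‖ := by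
    set S : Set ℂ := Metric.closedBall 0 r \ Metric.ball (q0 : ℂ) d with hS
    have hSc : IsCompact S := (isCompact_closedBall 0 r).diff Metric.isOpen_ball
    have hSF : ContinuousOn (fun q => ‖F q‖) S := by
      apply ContinuousOn.norm
      intro z hz
      exact (hFd z (by simpa using hz.1)).continuousAt.continuousWithinAt
    by_cases hne : S.Nonempty
    · obtain ⟨z, hz, hmin⟩ := hSc.exists_isMinOn hne hSF
      refine ⟨‖F z‖, ?_, ?_⟩
      · rw [norm_pos_iff]
        intro hz0
        have h1 : ‖z‖ ≤ r := by simpa using hz.1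
        have := huniq z (by linarith) hz0
        have h2 := hz.2
        rw [this] at h2
        exact h2 (Metric.mem_ball_self hdpos)
      · intro q hq1 hq2
        apply hmin
        refine ⟨by simpa using hq1, ?_⟩
        rw [Metric.mem_ball, dist_eq_norm]
        linarith
    · refine ⟨1, one_pos, fun q hq1 hq2 => ?_⟩
      exfalso
      apply hne
      refine ⟨q, by simpa using hq1, ?_⟩
      rw [Metric.mem_ball, dist_eq_norm]
      linarith
  set η : ℝ := min (‖c‖ * d / 16) (m / 2) with hη
  have hηpos : 0 < η := by positivity
  filter_upwards [hFn, hunif η hηpos, hreal] with n hFn hun hre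
  have hFnd : ∀ z : ℂ, ‖z‖ ≤ r → DifferentiableAt ℂ (Fn n) z := fun z hz =>
    hFn.differentiableAt (Metric.isOpen_ball.mem_nhds (by rw [mem_ball_zero_iff]; linarith))
  have hη1 : η ≤ ‖c‖ * d / 16 := min_le_left _ _
  have hη2 : η ≤ m / 2 := min_le_right _ _
  have hderivF : ∀ z : ℂ, ‖z - q0‖ < 2 * d → ‖deriv F z - c‖ ≤ ‖c‖ / 8 := by
    intro z hz
    have := hδ1c (x := z) (by rw [dist_eq_norm]; linarith)
    rw [dist_eq_norm] at this
    exact this.le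
  have hderivn : ∀ z : ℂ, ‖z - q0‖ ≤ d → ‖deriv (Fn n) z - c‖ ≤ ‖c‖ / 4 := by
    intro z hz
    have hzr := hsub z (by linarith)
    have hball : ∀ w : ℂ, ‖w - z‖ ≤ d / 2 → ‖w‖ ≤ r := by
      intro w hw
      apply hsub
      have := norm_add_le (w - z) (z - q0)
      rw [sub_add_sub_cancel] at this
      linarith
    have h1 : ‖deriv (fun q => Fn n q - F q) z‖ ≤ η / (d / 2) := by
      apply Complex.norm_deriv_le_of_forall_mem_sphere_norm_le (by positivity)
      · apply DifferentiableOn.diffContOnCl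
        rw [closure_ball z (by positivity)]
        intro w hw
        have hw' := hball w (by simpa [dist_eq_norm] using hw)
        exact ((hFnd w hw').sub (hFd w hw')).differentiableWithinAt
      · intro w hw
        apply hun
        have hw' := hball w (by
          have := (mem_sphere_iff_norm.mp hw); linarith)
        linarith
    have h2 : deriv (fun q => Fn n q - F q) z = deriv (Fn n) z - deriv F z :=
      ((hFnd z hzr).hasDerivAt.sub (hFd z hzr).hasDerivAt).deriv
    rw [h2] at h1
    have h3 := hderivF z (by linarith)
    have h4 : η / (d / 2) ≤ ‖c‖ / 8 := by
      rw [div_le_iff₀ (by positivity)]; linarith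
    have h5 := norm_add_le (deriv (Fn n) z - deriv F z) (deriv F z - c)
    rw [sub_add_sub_cancel] at h5
    linarith
  have hlipn : ∀ z w : ℂ, ‖z - q0‖ ≤ d → ‖w - q0‖ ≤ d →
      ‖Fn n z - Fn n w - c * (z - w)‖ ≤ ‖c‖ / 4 * ‖z - w‖ := by
    intro z w hz hw
    have key := Convex.norm_image_sub_le_of_norm_hasDerivWithin_le
      (f := fun q => Fn n q - c * q) (f' := fun q => deriv (Fn n) q - c)
      (s := Metric.closedBall (q0 : ℂ) d) (x := w) (y := z) (C := ‖c‖ / 4)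
      (fun q hq => by
        have hq' : ‖q - q0‖ ≤ d := by simpa [dist_eq_norm] using hq
        have h1 := (hFnd q (hsub q (by linarith))).hasDerivAt
        have h2 := (hasDerivAt_id q).const_mul c
        have h3 := h1.sub h2
        simp only [mul_one] at h3
        exact h3.hasDerivWithinAt)
      (fun q hq => hderivn q (by simpa [dist_eq_norm] using hq))
      (convex_closedBall _ _)
      (by simpa [dist_eq_norm] using hw) (by simpa [dist_eq_norm] using hz)
    have e : Fn n z - Fn n w - c * (z - w) = Fn n z - c * z - (Fn n w - c * w) := by ring
    rw [e]; exact key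
  -- existence
  have hFnq0 : ‖Fn n q0‖ ≤ ‖c‖ * d / 16 := by
    have := hun q0 (by simpa using hq0R)
    rw [h0, sub_zero] at this
    linarith
  have hex : ∃ x : ℝ, |x - q0| ≤ d ∧ Fn n x = 0 := by
    set a : ℝ := (Fn n ((q0 + d : ℝ) : ℂ)).re with ha
    set b : ℝ := (Fn n ((q0 - d : ℝ) : ℂ)).re with hb
    have hxR : ∀ x : ℝ, |x - q0| ≤ d → |x| < R := by
      intro x hx
      have := hsub x (by
        rw [← Complex.ofReal_sub, Complex.norm_real, Real.norm_eq_abs]; linarith)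
      rw [Complex.norm_real, Real.norm_eq_abs] at this
      linarith
    have hre' : ∀ x : ℝ, |x - q0| ≤ d → (((Fn n x).re : ℝ) : ℂ) = Fn n x := by
      intro x hx
      apply Complex.ext
      · simp
      · simp [hre x (hxR x hx)]
    have hda : |q0 + d - q0| ≤ d := by rw [add_sub_cancel_left, abs_of_pos hdpos]
    have hdb : |q0 - d - q0| ≤ d := by
      rw [sub_sub_cancel_left, abs_neg, abs_of_pos hdpos]
    have hadist : ‖((q0 + d : ℝ) : ℂ) - q0‖ = d := by
      rw [← Complex.ofReal_sub, Complex.norm_real, Real.norm_eq_abs, add_sub_cancel_left,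
        abs_of_pos hdpos]
    have hbdist : ‖((q0 - d : ℝ) : ℂ) - q0‖ = d := by
      rw [← Complex.ofReal_sub, Complex.norm_real, Real.norm_eq_abs, sub_sub_cancel_left, abs_neg,
        abs_of_pos hdpos]
    have hA := hlipn ((q0 + d : ℝ) : ℂ) q0 hadist.le (by simp [hdpos.le])
    have hB := hlipn ((q0 - d : ℝ) : ℂ) q0 hbdist.le (by simp [hdpos.le])
    rw [hadist, ← hre' _ hda] at hA
    rw [hbdist, ← hre' _ hdb] at hB
    have eA : (((q0 + d : ℝ) : ℂ) - q0) = (d : ℂ) := by push_cast; ring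
    have eB : (((q0 - d : ℝ) : ℂ) - q0) = -(d : ℂ) := by push_cast; ring
    rw [eA, ← ha] at hA
    rw [eB, ← hb] at hB
    have hdn : ‖(d : ℂ)‖ = d := by rw [Complex.norm_real, Real.norm_eq_abs, abs_of_pos hdpos]
    -- sum and difference
    have hsum : |a + b| ≤ ‖c‖ * d * (5 / 8) := by
      have e : (((a + b : ℝ)) : ℂ) = ((a : ℂ) - Fn n q0 - c * d) + ((b : ℂ) - Fn n q0 - c * -d)
          + 2 * Fn n q0 := by push_cast; ring
      have := norm_add₃_le (a := ((a : ℂ) - Fn n q0 - c * d)) (b := ((b : ℂ) - Fn n q0 - c * -d))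
        (c := 2 * Fn n q0)
      rw [← e, Complex.norm_real, Real.norm_eq_abs, norm_mul] at this
      norm_num at this
      norm_num at hA hB
      linarith
    have hdiff : ‖c‖ * d * (3 / 2) ≤ |a - b| := by
      have e : 2 * (c * d) = (((a - b : ℝ)) : ℂ) + (((b : ℂ) - Fn n q0 - c * -d)
          - ((a : ℂ) - Fn n q0 - c * d)) := by push_cast; ring
      have h1 := norm_add_le (((a - b : ℝ)) : ℂ) (((b : ℂ) - Fn n q0 - c * -d)
          - ((a : ℂ) - Fn n q0 - c * d))
      have h2 := norm_sub_le ((b : ℂ) - Fn n q0 - c * -d) ((a : ℂ) - Fn n q0 - c * d)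
      rw [← e, Complex.norm_real, Real.norm_eq_abs, norm_mul, norm_mul, hdn] at h1
      norm_num at h1
      norm_num at h2 hA hB
      linarith
    have hX : 0 < ‖c‖ * d := by positivity
    have hab : a * b < 0 := by
      have h1 : (a + b) ^ 2 ≤ (‖c‖ * d * (5 / 8)) ^ 2 := by
        rw [← sq_abs (a + b)]; gcongr
      have h2 : (‖c‖ * d * (3 / 2)) ^ 2 ≤ (a - b) ^ 2 := by
        rw [← sq_abs (a - b)]; gcongr
      nlinarith
    have hcontR : ContinuousOn (fun x : ℝ => (Fn n x).re) (Set.Icc (q0 - d) (q0 + d)) := by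
      refine Complex.continuous_re.comp_continuousOn ?_
      refine hFn.continuousOn.comp Complex.continuous_ofReal.continuousOn ?_
      intro x hx
      rw [mem_ball_zero_iff, Complex.norm_real, Real.norm_eq_abs]
      apply hxR
      rw [abs_le]
      constructor <;> linarith [hx.1, hx.2]
    have hle : q0 - d ≤ q0 + d := by linarith
    have hfin : ∃ x ∈ Set.Icc (q0 - d) (q0 + d), (Fn n x).re = 0 := by
      rcases mul_neg_iff.mp hab with ⟨h1, h2⟩ | ⟨h1, h2⟩
      · exact intermediate_value_Icc hle hcontR ⟨h2.le, h1.le⟩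
      · exact intermediate_value_Icc' hle hcontR ⟨h1.le, h2.le⟩
    obtain ⟨x, hx, hx0⟩ := hfin
    have hxd : |x - q0| ≤ d := by rw [abs_le]; constructor <;> linarith [hx.1, hx.2]
    exact ⟨x, hxd, by rw [← hre' x hxd, hx0]; simp⟩
  obtain ⟨x, hxd, hx0⟩ := hex
  have hxn : ‖(x : ℂ) - q0‖ ≤ d := by
    rw [← Complex.ofReal_sub, Complex.norm_real, Real.norm_eq_abs]; exact hxd
  refine ⟨x, hxd.trans hdδ, hx0, ?_, ?_⟩
  · intro hz
    have := hderivn x hxn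
    rw [hz, zero_sub, norm_neg] at this
    linarith
  · intro q hq hqz
    by_cases hqd : ‖q - q0‖ ≤ d
    · have := hlipn q x hqd hxn
      rw [hqz, hx0, sub_zero, zero_sub, norm_neg, norm_mul] at this
      by_contra hne
      have : 0 < ‖q - x‖ := norm_pos_iff.mpr (sub_ne_zero.mpr hne)
      nlinarith
    · exfalso
      have h1 := hmF q hq (by linarith)
      have h2 := hun q (by linarith)
      rw [hqz, zero_sub, norm_neg] at h2
      linarith

/-! ### Part D : the finite matrices -/

open Matrix in
/-- `I - M_K` -/
def AM (t K N : ℕ) (q : ℂ) : Matrix (Fin N) (Fin N) ℂ :=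
  Matrix.of fun r s : Fin N =>
    (if r = s then (1 : ℂ) else 0)
      - q ^ ((r : ℕ) + 1) *
        (if (r : ℕ) + 1 ≤ t * ((s : ℕ) + 1) ∧ t * ((s : ℕ) + 1) ≤ (r : ℕ) + 1 + K
          then 1 else 0)

/-- `I + L + U` -/
def BM (t K N : ℕ) (q : ℂ) : Matrix (Fin N) (Fin N) ℂ :=
  Matrix.of fun r s : Fin N =>
    (if r = s then (1 : ℂ) else 0)
      + q ^ ((r : ℕ) + 1) *
        (if (r : ℕ) + 1 ≤ t * ((s : ℕ) + 1) ∧ t * ((s : ℕ) + 1) ≤ (r : ℕ) + 1 + K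
          then 0 else 1)

def pv (N : ℕ) (q : ℂ) : Fin N → ℂ := fun r => q ^ ((r : ℕ) + 1)

def ov (N : ℕ) : Fin N → ℂ := fun _ => 1

/-- the small parameter -/
def epsK (t K : ℕ) : ℝ := 0.915 ^ (K / t)

def phK (t K N : ℕ) (q : ℂ) : Fin N → ℂ := Matrix.vecMul (ov N) (BM t K N q)⁻¹

def zK (t K N : ℕ) (q : ℂ) : Fin N → ℂ := Matrix.mulVec (BM t K N q)⁻¹ (pv N q)

def fK (t K N : ℕ) (q : ℂ) : ℂ := 1 - ∑ r, phK t K N q r * q ^ ((r : ℕ) + 1)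

lemma epsK_pos (t K : ℕ) : 0 < epsK t K := by unfold epsK; positivity

lemma geom_ite_le {x : ℝ} (h0 : 0 ≤ x) (h1 : x < 1) (m N : ℕ) :
    ∑ r ∈ Finset.range N, (if m ≤ r then x ^ (r + 1) else 0) ≤ x ^ (m + 1) / (1 - x) := by
  have key : ∑ r ∈ Finset.range N, (if m ≤ r then x ^ (r + 1) else 0)
      ≤ (x ^ (m + 1) - x ^ (max m N + 1)) / (1 - x) := by
    have hx : 0 < 1 - x := by linarith
    induction N with
    | zero => simp
    | succ N ih =>
      rw [Finset.sum_range_succ]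
      split_ifs with h
      · have e1 : max m N = N := by omega
        have e2 : max m (N + 1) = N + 1 := by omega
        rw [e1] at ih
        rw [e2]
        rw [le_div_iff₀ hx] at ih ⊢
        have : x ^ (N + 1 + 1) = x ^ (N + 1) * x := pow_succ _ _
        rw [this]
        linarith
      · have e1 : max m N = m := by omega
        have e2 : max m (N + 1) = m := by omega
        rw [e1] at ih
        rw [e2]
        linarith
  refine key.trans ?_
  have hx : 0 < 1 - x := by linarith
  have : 0 ≤ x ^ (max m N + 1) := by positivity
  gcongr
  linarith

lemma ncnd_le {t K r s : ℕ} {v : ℝ} (hv : 0 ≤ v) :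
    (if r + 1 ≤ t * (s + 1) ∧ t * (s + 1) ≤ r + 1 + K then 0 else v) ≤
      (if t * (s + 1) ≤ r then v else 0) + (if K < t * (s + 1) then v else 0) := by
  split_ifs <;> first | linarith | (exfalso; omega)

lemma rho_pow_le {t K s : ℕ} (ht : 2 ≤ t) (h : K < t * (s + 1)) :
    (0.915 : ℝ) ^ (s + 1) ≤ epsK t K := by
  unfold epsK
  apply pow_le_pow_of_le_one (by norm_num) (by norm_num)
  have : K / t < s + 1 := by rw [Nat.div_lt_iff_lt_mul (by omega)]; rwa [mul_comm]
  omega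

lemma col_contract {t K N s : ℕ} (ht : 2 ≤ t) :
    (0.915 : ℝ) ^ (s + 1) * ∑ r ∈ Finset.range N,
      (if r + 1 ≤ t * (s + 1) ∧ t * (s + 1) ≤ r + 1 + K then 0 else (2 / 3 : ℝ) ^ (r + 1)) ≤
      0.82 + 2 * epsK t K := by
  have h1 : ∑ r ∈ Finset.range N,
      (if r + 1 ≤ t * (s + 1) ∧ t * (s + 1) ≤ r + 1 + K then 0 else (2 / 3 : ℝ) ^ (r + 1)) ≤
      (2 / 3 : ℝ) ^ (t * (s + 1) + 1) / (1 - 2 / 3) + (if K < t * (s + 1) then 2 else 0) := by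
    refine (Finset.sum_le_sum (fun r _ => ncnd_le (by positivity))).trans ?_
    rw [Finset.sum_add_distrib]
    refine add_le_add (geom_ite_le (by norm_num) (by norm_num) _ _) ?_
    split_ifs with h
    · have := geom_ite_le (x := 2 / 3) (by norm_num) (by norm_num) 0 N
      simp only [Nat.zero_le, if_true] at this
      refine this.trans (by norm_num)
    · simp
  have hp1 : (0 : ℝ) < 0.915 ^ (s + 1) := by positivity
  have h2 : (0.915 : ℝ) ^ (s + 1) * (if K < t * (s + 1) then 2 else 0) ≤ 2 * epsK t K := by
    split_ifs with h
    · have := rho_pow_le ht h; linarith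
    · have := epsK_pos t K; simp; linarith
  have h3 : (0.915 : ℝ) ^ (s + 1) * ((2 / 3 : ℝ) ^ (t * (s + 1) + 1) / (1 - 2 / 3)) ≤ 0.82 := by
    have a1 : (0.915 : ℝ) ^ (s + 1) ≤ 0.915 ^ 1 :=
      pow_le_pow_of_le_one (by norm_num) (by norm_num) (by omega)
    have a2 : (2 / 3 : ℝ) ^ (t * (s + 1) + 1) ≤ (2 / 3) ^ 3 :=
      pow_le_pow_of_le_one (by norm_num) (by norm_num) (by nlinarith)
    calc _ ≤ (0.915 : ℝ) ^ 1 * ((2 / 3) ^ 3 / (1 - 2 / 3)) := by gcongr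
      _ ≤ _ := by norm_num
  calc _ ≤ (0.915 : ℝ) ^ (s + 1) * ((2 / 3 : ℝ) ^ (t * (s + 1) + 1) / (1 - 2 / 3)
        + (if K < t * (s + 1) then 2 else 0)) := by gcongr
    _ ≤ _ := by rw [mul_add]; linarith

lemma vecMul_BM (t K N : ℕ) (q : ℂ) (v : Fin N → ℂ) (s : Fin N) :
    Matrix.vecMul v (BM t K N q) s = v s + ∑ r : Fin N,
      (if (r : ℕ) + 1 ≤ t * ((s : ℕ) + 1) ∧ t * ((s : ℕ) + 1) ≤ (r : ℕ) + 1 + K then 0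
        else v r * q ^ ((r : ℕ) + 1)) := by
  simp only [Matrix.vecMul, dotProduct, BM, Matrix.of_apply, mul_add, Finset.sum_add_distrib]
  congr 1
  · simp
  · apply Finset.sum_congr rfl
    intro r _
    split_ifs <;> simp

lemma BM_bound {t K N : ℕ} (ht : 2 ≤ t) (he : epsK t K ≤ 0.05) {q : ℂ} (hq : ‖q‖ ≤ 0.61)
    (v : Fin N → ℂ) (C : ℝ)
    (hC : ∀ s : Fin N, (0.915 : ℝ) ^ ((s : ℕ) + 1) * ‖Matrix.vecMul v (BM t K N q) s‖ ≤ C) :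
    ∀ s : Fin N, (0.915 : ℝ) ^ ((s : ℕ) + 1) * ‖v s‖ ≤ 20 * C := by
  intro s0
  have : Nonempty (Fin N) := ⟨s0⟩
  obtain ⟨s, hs⟩ := Finite.exists_max (fun s : Fin N => (0.915 : ℝ) ^ ((s : ℕ) + 1) * ‖v s‖)
  refine (hs s0).trans ?_
  set m := (0.915 : ℝ) ^ ((s : ℕ) + 1) * ‖v s‖ with hm
  have hm0 : 0 ≤ m := by positivity
  have h1 := hC s
  have e := vecMul_BM t K N q v s
  have hcc := col_contract (t := t) (K := K) (N := N) (s := s) ht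
  have h2 : ‖∑ r : Fin N,
      (if (r : ℕ) + 1 ≤ t * ((s : ℕ) + 1) ∧ t * ((s : ℕ) + 1) ≤ (r : ℕ) + 1 + K then 0
        else v r * q ^ ((r : ℕ) + 1))‖ ≤ m * ∑ r ∈ Finset.range N,
      (if r + 1 ≤ t * ((s : ℕ) + 1) ∧ t * ((s : ℕ) + 1) ≤ r + 1 + K then 0
        else (2 / 3 : ℝ) ^ (r + 1)) := by
    rw [Finset.mul_sum, ← Fin.sum_univ_eq_sum_range (fun r => m * (if r + 1 ≤ t * ((s : ℕ) + 1) ∧ t * ((s : ℕ) + 1) ≤ r + 1 + K then 0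
        else (2 / 3 : ℝ) ^ (r + 1)))]
    refine norm_sum_le_of_le _ (fun r _ => ?_)
    split_ifs
    · simp
    · rw [norm_mul, norm_pow]
      have a1 := hs r
      calc ‖v r‖ * ‖q‖ ^ ((r : ℕ) + 1) ≤ ‖v r‖ * (0.915 * (2 / 3)) ^ ((r : ℕ) + 1) := by
            gcongr
            refine hq.trans (by norm_num)
        _ = (0.915 ^ ((r : ℕ) + 1) * ‖v r‖) * (2 / 3) ^ ((r : ℕ) + 1) := by
            rw [mul_pow]; ring
        _ ≤ _ := by gcongr
  have hv : ‖v s‖ ≤ ‖Matrix.vecMul v (BM t K N q) s‖ + m * ∑ r ∈ Finset.range N,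
      (if r + 1 ≤ t * ((s : ℕ) + 1) ∧ t * ((s : ℕ) + 1) ≤ r + 1 + K then 0
        else (2 / 3 : ℝ) ^ (r + 1)) := by
    have := norm_sub_le (Matrix.vecMul v (BM t K N q) s) (∑ r : Fin N,
      (if (r : ℕ) + 1 ≤ t * ((s : ℕ) + 1) ∧ t * ((s : ℕ) + 1) ≤ (r : ℕ) + 1 + K then 0
        else v r * q ^ ((r : ℕ) + 1)))
    rw [e, add_sub_cancel_right, ← e] at this
    linarith
  have hp1 : (0 : ℝ) < 0.915 ^ ((s : ℕ) + 1) := by positivity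
  have h3 : m ≤ C + m * (0.82 + 2 * epsK t K) := by
    calc m ≤ 0.915 ^ ((s : ℕ) + 1) * (‖Matrix.vecMul v (BM t K N q) s‖ + m * ∑ r ∈ Finset.range N,
      (if r + 1 ≤ t * ((s : ℕ) + 1) ∧ t * ((s : ℕ) + 1) ≤ r + 1 + K then 0
        else (2 / 3 : ℝ) ^ (r + 1))) := by rw [hm]; gcongr
      _ = 0.915 ^ ((s : ℕ) + 1) * ‖Matrix.vecMul v (BM t K N q) s‖ + m * (0.915 ^ ((s : ℕ) + 1) * ∑ r ∈ Finset.range N,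
      (if r + 1 ≤ t * ((s : ℕ) + 1) ∧ t * ((s : ℕ) + 1) ≤ r + 1 + K then 0
        else (2 / 3 : ℝ) ^ (r + 1))) := by ring
      _ ≤ _ := by gcongr
  nlinarith

lemma BM_det_ne {t K N : ℕ} (ht : 2 ≤ t) (he : epsK t K ≤ 0.05) {q : ℂ} (hq : ‖q‖ ≤ 0.61) :
    (BM t K N q).det ≠ 0 := by
  intro h
  obtain ⟨v, hv, hv0⟩ := Matrix.exists_vecMul_eq_zero_iff.mpr h
  apply hv
  funext s
  have := BM_bound ht he hq v 0 (fun s => by rw [hv0]; simp) s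
  simp only [mul_zero] at this
  have hp1 : (0 : ℝ) < 0.915 ^ ((s : ℕ) + 1) := by positivity
  have h2 : ‖v s‖ ≤ 0 := by
    by_contra h3
    push Not at h3
    nlinarith
  simpa using h2

lemma BM_unit {t K N : ℕ} (ht : 2 ≤ t) (he : epsK t K ≤ 0.05) {q : ℂ} (hq : ‖q‖ ≤ 0.61) :
    IsUnit (BM t K N q).det := (BM_det_ne ht he hq).isUnit

lemma phK_spec {t K N : ℕ} (ht : 2 ≤ t) (he : epsK t K ≤ 0.05) {q : ℂ} (hq : ‖q‖ ≤ 0.61) :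
    Matrix.vecMul (phK t K N q) (BM t K N q) = ov N := by
  rw [phK, Matrix.vecMul_vecMul, Matrix.nonsing_inv_mul _ (BM_unit ht he hq), Matrix.vecMul_one]

lemma zK_spec {t K N : ℕ} (ht : 2 ≤ t) (he : epsK t K ≤ 0.05) {q : ℂ} (hq : ‖q‖ ≤ 0.61) :
    Matrix.mulVec (BM t K N q) (zK t K N q) = pv N q := by
  rw [zK, Matrix.mulVec_mulVec, Matrix.mul_nonsing_inv _ (BM_unit ht he hq), Matrix.one_mulVec]

lemma ph_tail {t : ℕ} (ht : 2 ≤ t) {q : ℂ} (hq : ‖q‖ ≤ 0.61) (m N : ℕ)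
    (hs : Summable (fun k => ph t q (k + 1) * q ^ (k + 1))) :
    ‖∑ r ∈ Finset.range N, (if m ≤ r then ph t q (r + 1) * q ^ (r + 1) else 0) -
      ∑' k, ph t q (m + k + 1) * q ^ (m + k + 1)‖ ≤ 24 * 0.61 ^ N := by
  set a : ℕ → ℂ := fun k => ph t q (k + 1) * q ^ (k + 1) with ha
  have hta : ∀ n, N ≤ n → ‖∑' k, a (n + k)‖ ≤ 24 * 0.61 ^ N := by
    intro n hn
    have hg : HasSum (fun k : ℕ => 9 * (0.61 : ℝ) ^ (N + 1) * 0.61 ^ k)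
        (9 * 0.61 ^ (N + 1) * (1 - 0.61)⁻¹) :=
      (hasSum_geometric_of_lt_one (by norm_num) (by norm_num)).mul_left _
    refine (tsum_of_norm_bounded hg (fun k => ?_)).trans ?_
    · simp only [ha]
      rw [norm_mul, mul_assoc, ← pow_add]
      have h1 := norm_ph ht hq (n + k + 1)
      have h2 : ‖q ^ (n + k + 1)‖ ≤ 0.61 ^ (N + 1 + k) := norm_pow_le_rn hq (by norm_num) (by omega)
      gcongr
    · have : (0 : ℝ) < 0.61 ^ N := by positivity
      rw [pow_succ]
      norm_num
      nlinarith
  have hgoal : ∀ k, ph t q (m + k + 1) * q ^ (m + k + 1) = a (m + k) := fun k => rfl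
  simp_rw [hgoal]
  by_cases hmN : N ≤ m
  · have : ∑ r ∈ Finset.range N, (if m ≤ r then ph t q (r + 1) * q ^ (r + 1) else 0) = 0 := by
      apply Finset.sum_eq_zero
      intro r hr
      rw [Finset.mem_range] at hr
      rw [if_neg (by omega)]
    rw [this, zero_sub, norm_neg]
    exact hta m hmN
  · push Not at hmN
    have hs' : Summable (fun k => a (m + k)) := by
      have := (summable_nat_add_iff m).mpr hs
      simpa [add_comm] using this
    have h1 := hs'.sum_add_tsum_nat_add (N - m)
    have h2 : ∑ r ∈ Finset.range N, (if m ≤ r then ph t q (r + 1) * q ^ (r + 1) else 0)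
        = ∑ i ∈ Finset.range (N - m), a (m + i) := by
      rw [← Finset.sum_filter]
      have : (Finset.range N).filter (fun r => m ≤ r) = Finset.Ico m N := by
        ext r; simp; omega
      rw [this, Finset.sum_Ico_eq_sum_range]
    rw [h2, ← h1, sub_add_cancel_left, norm_neg]
    have h3 : ∀ i, a (m + (i + (N - m))) = a (N + i) := by
      intro i; congr 1; omega
    simp_rw [h3]
    exact hta N le_rfl

lemma ph_summable {t : ℕ} (ht : 2 ≤ t) {q : ℂ} (hq : ‖q‖ ≤ 0.61) :
    Summable (fun k => ph t q (k + 1) * q ^ (k + 1)) := by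
  have := (ph_rec ht hq 0).summable
  simpa using this

lemma phK_close {t K N : ℕ} (ht : 2 ≤ t) (he : epsK t K ≤ 0.05) (hN : K / t ≤ N + 1)
    {q : ℂ} (hq : ‖q‖ ≤ 0.61) (s : Fin N) :
    (0.915 : ℝ) ^ ((s : ℕ) + 1) * ‖ph t q ((s : ℕ) + 1) - phK t K N q s‖ ≤ 1000 * epsK t K := by
  have hN61 : (0.61 : ℝ) ^ N ≤ 1.1 * epsK t K := by
    have h1 : (0.61 : ℝ) ^ N ≤ 0.915 ^ N := by gcongr; norm_num
    have h2 : (0.915 : ℝ) ^ (N + 1) ≤ epsK t K :=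
      pow_le_pow_of_le_one (by norm_num) (by norm_num) hN
    rw [pow_succ] at h2
    nlinarith [epsK_pos t K]
  have key := BM_bound ht he hq (fun s : Fin N => ph t q ((s : ℕ) + 1) - phK t K N q s)
    (50 * epsK t K) ?_ s
  · linarith
  intro s
  have hsub : Matrix.vecMul (fun s : Fin N => ph t q ((s : ℕ) + 1) - phK t K N q s) (BM t K N q) s
      = Matrix.vecMul (fun s : Fin N => ph t q ((s : ℕ) + 1)) (BM t K N q) s - 1 := by
    have h1 : (fun s : Fin N => ph t q ((s : ℕ) + 1) - phK t K N q s) =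
      (fun s : Fin N => ph t q ((s : ℕ) + 1)) - phK t K N q := rfl
    rw [h1, Matrix.sub_vecMul, phK_spec ht he hq]
    rfl
  rw [hsub, vecMul_BM]
  have hrec := ph_rec ht hq ((s : ℕ) + 1)
  set m := t * ((s : ℕ) + 1) with hm
  have hrec' := hrec.tsum_eq
  have e1 : ph t q ((s : ℕ) + 1) = 1 - ∑' k, ph t q (m + k + 1) * q ^ (m + k + 1) := by
    rw [hrec']; ring
  rw [e1]
  have e2 : ∑ r : Fin N, (if (r : ℕ) + 1 ≤ m ∧ m ≤ (r : ℕ) + 1 + K then 0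
        else ph t q ((r : ℕ) + 1) * q ^ ((r : ℕ) + 1)) =
      ∑ r ∈ Finset.range N, (if m ≤ r then ph t q (r + 1) * q ^ (r + 1) else 0) +
      ∑ r ∈ Finset.range N, (if r + 1 + K < m then ph t q (r + 1) * q ^ (r + 1) else 0) := by
    rw [← Finset.sum_add_distrib, ← Fin.sum_univ_eq_sum_range (fun r => (if m ≤ r then ph t q (r + 1) * q ^ (r + 1) else 0) + (if r + 1 + K < m then ph t q (r + 1) * q ^ (r + 1) else 0))]
    apply Finset.sum_congr rfl
    intro r _
    split_ifs <;> first | (exfalso; omega) | simp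
  rw [e2]
  have h3 := ph_tail ht hq m N (ph_summable ht hq)
  have h4 : ‖∑ r ∈ Finset.range N, (if r + 1 + K < m then ph t q (r + 1) * q ^ (r + 1) else 0)‖
      ≤ if K < m then 15 else 0 := by
    split_ifs with hK
    · calc _ ≤ ∑ r ∈ Finset.range N, 9 * (if 0 ≤ r then (0.61 : ℝ) ^ (r + 1) else 0) := by
            refine norm_sum_le_of_le _ (fun r _ => ?_)
            simp only [Nat.zero_le, if_true]
            split_ifs
            · rw [norm_mul]
              have h1 := norm_ph ht hq (r + 1)
              have h2 : ‖q ^ (r + 1)‖ ≤ 0.61 ^ (r + 1) := norm_pow_le_rn hq (by norm_num) le_rfl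
              gcongr
            · simp; positivity
        _ ≤ 9 * (0.61 ^ (0 + 1) / (1 - 0.61)) := by
            rw [← Finset.mul_sum]
            have := geom_ite_le (x := 0.61) (by norm_num) (by norm_num) 0 N
            gcongr
        _ ≤ _ := by norm_num
    · rw [Finset.sum_eq_zero]
      · simp
      · intro r _
        rw [if_neg (by omega)]
  have hp1 : (0 : ℝ) < 0.915 ^ ((s : ℕ) + 1) := by positivity
  have hp2 : (0.915 : ℝ) ^ ((s : ℕ) + 1) ≤ 1 := pow_le_one₀ (by norm_num) (by norm_num)
  have h5 : (0.915 : ℝ) ^ ((s : ℕ) + 1) * (if K < m then 15 else 0) ≤ 15 * epsK t K := by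
    split_ifs with h
    · have := rho_pow_le (s := s) ht h; linarith
    · have := epsK_pos t K; simp; linarith
  have e3 : ∀ S T U : ℂ, 1 - T + (S + U) - 1 = (S - T) + U := by intros; ring
  rw [e3]
  have h6 := (norm_add_le _ _).trans (add_le_add h3 h4)
  calc _ ≤ (0.915 : ℝ) ^ ((s : ℕ) + 1) * (24 * 0.61 ^ N + if K < m then 15 else 0) := by gcongr
    _ = (0.915 : ℝ) ^ ((s : ℕ) + 1) * (24 * 0.61 ^ N) +
        0.915 ^ ((s : ℕ) + 1) * (if K < m then 15 else 0) := by ring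
    _ ≤ 1 * (24 * 0.61 ^ N) + 15 * epsK t K := by gcongr
    _ ≤ _ := by linarith [epsK_pos t K]

lemma fK_close {t K N : ℕ} (ht : 2 ≤ t) (he : epsK t K ≤ 0.05) (hN : K / t ≤ N + 1)
    {q : ℂ} (hq : ‖q‖ ≤ 0.61) :
    ‖fK t K N q - ph t q 0‖ ≤ 3000 * epsK t K := by
  have hN61 : (0.61 : ℝ) ^ N ≤ 1.1 * epsK t K := by
    have h1 : (0.61 : ℝ) ^ N ≤ 0.915 ^ N := by gcongr; norm_num
    have h2 : (0.915 : ℝ) ^ (N + 1) ≤ epsK t K :=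
      pow_le_pow_of_le_one (by norm_num) (by norm_num) hN
    rw [pow_succ] at h2
    nlinarith [epsK_pos t K]
  have hrec := (ph_rec ht hq 0).tsum_eq
  have h3 := ph_tail ht hq 0 N (ph_summable ht hq)
  simp only [mul_zero] at hrec
  rw [hrec] at h3
  simp only [Nat.zero_le, if_true] at h3
  rw [← Fin.sum_univ_eq_sum_range (fun r => ph t q (r + 1) * q ^ (r + 1))] at h3
  have e : fK t K N q - ph t q 0 = ∑ r : Fin N, (ph t q ((r : ℕ) + 1) - phK t K N q r) * q ^ ((r : ℕ) + 1)
      - (∑ r : Fin N, ph t q ((r : ℕ) + 1) * q ^ ((r : ℕ) + 1) - (1 - ph t q 0)) := by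
    unfold fK
    simp only [sub_mul, Finset.sum_sub_distrib]
    ring
  rw [e]
  refine (norm_sub_le _ _).trans ?_
  have h4 : ‖∑ r : Fin N, (ph t q ((r : ℕ) + 1) - phK t K N q r) * q ^ ((r : ℕ) + 1)‖ ≤
      1000 * epsK t K * 2 := by
    calc _ ≤ ∑ r : Fin N, 1000 * epsK t K * (if 0 ≤ (r : ℕ) then (2 / 3 : ℝ) ^ ((r : ℕ) + 1) else 0) := by
          refine norm_sum_le_of_le _ (fun r _ => ?_)
          simp only [Nat.zero_le, if_true]
          have := phK_close ht he hN hq r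
          rw [norm_mul, norm_pow]
          calc _ ≤ ‖ph t q ((r : ℕ) + 1) - phK t K N q r‖ * (0.915 * (2 / 3)) ^ ((r : ℕ) + 1) := by
                gcongr
                refine hq.trans (by norm_num)
            _ = (0.915 ^ ((r : ℕ) + 1) * ‖ph t q ((r : ℕ) + 1) - phK t K N q r‖) * (2 / 3) ^ ((r : ℕ) + 1) := by
                rw [mul_pow]; ring
            _ ≤ _ := by gcongr
      _ ≤ 1000 * epsK t K * ((2 / 3) ^ (0 + 1) / (1 - 2 / 3)) := by
          rw [← Finset.mul_sum, Fin.sum_univ_eq_sum_range (fun r => (if 0 ≤ r then (2 / 3 : ℝ) ^ (r + 1) else 0))]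
          have := geom_ite_le (x := 2 / 3) (by norm_num) (by norm_num) 0 N
          have := epsK_pos t K
          gcongr
      _ ≤ _ := by norm_num
  linarith [epsK_pos t K]

/-! ### Part E : analyticity, realness, linear algebra -/

lemma diffOn_det {N : ℕ} {S : Set ℂ} {A : ℂ → Matrix (Fin N) (Fin N) ℂ}
    (h : ∀ i j, DifferentiableOn ℂ (fun q => A q i j) S) :
    DifferentiableOn ℂ (fun q => (A q).det) S := by
  simp only [Matrix.det_apply]
  apply DifferentiableOn.fun_sum
  intro σ _
  apply DifferentiableOn.const_smul
  apply DifferentiableOn.fun_finsetProd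
  intro i _
  exact h _ _

lemma diffOn_adj {N : ℕ} {S : Set ℂ} {A : ℂ → Matrix (Fin N) (Fin N) ℂ}
    (h : ∀ i j, DifferentiableOn ℂ (fun q => A q i j) S) (i j : Fin N) :
    DifferentiableOn ℂ (fun q => (A q).adjugate i j) S := by
  simp only [Matrix.adjugate_apply]
  apply diffOn_det
  intro a b
  simp only [Matrix.updateRow_apply]
  split_ifs
  · exact differentiableOn_const _
  · exact h _ _

lemma diffOn_BMinv {t K N : ℕ} (ht : 2 ≤ t) (he : epsK t K ≤ 0.05) (i j : Fin N) :
    DifferentiableOn ℂ (fun q => (BM t K N q)⁻¹ i j) (Metric.ball 0 0.61) := by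
  have hB : ∀ i j, DifferentiableOn ℂ (fun q => BM t K N q i j) (Metric.ball 0 0.61) := by
    intro i j
    simp only [BM, Matrix.of_apply]
    fun_prop
  simp only [Matrix.inv_def, Matrix.smul_apply, Ring.inverse_eq_inv', smul_eq_mul]
  refine DifferentiableOn.mul (DifferentiableOn.inv (diffOn_det hB) ?_) (diffOn_adj hB _ _)
  intro q hq
  exact BM_det_ne ht he (by simpa using (mem_ball_zero_iff.mp hq).le)

lemma diffOn_vecMul {t K N : ℕ} (ht : 2 ≤ t) (he : epsK t K ≤ 0.05) (v : Fin N → ℂ) (j : Fin N) :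
    DifferentiableOn ℂ (fun q => Matrix.vecMul v (BM t K N q)⁻¹ j) (Metric.ball 0 0.61) := by
  simp only [Matrix.vecMul, dotProduct]
  apply DifferentiableOn.fun_sum
  intro i _
  exact (diffOn_BMinv ht he i j).const_mul _

lemma diffOn_phK {t K N : ℕ} (ht : 2 ≤ t) (he : epsK t K ≤ 0.05) (j : Fin N) :
    DifferentiableOn ℂ (fun q => phK t K N q j) (Metric.ball 0 0.61) :=
  diffOn_vecMul ht he _ j

lemma diffOn_zK {t K N : ℕ} (ht : 2 ≤ t) (he : epsK t K ≤ 0.05) (j : Fin N) :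
    DifferentiableOn ℂ (fun q => zK t K N q j) (Metric.ball 0 0.61) := by
  simp only [zK, Matrix.mulVec, dotProduct]
  apply DifferentiableOn.fun_sum
  intro i _
  refine (diffOn_BMinv ht he j i).mul ?_
  simp only [pv]
  fun_prop

lemma diffOn_fK {t K N : ℕ} (ht : 2 ≤ t) (he : epsK t K ≤ 0.05) :
    DifferentiableOn ℂ (fun q => fK t K N q) (Metric.ball 0 0.61) := by
  unfold fK
  refine (differentiableOn_const _).sub ?_
  apply DifferentiableOn.fun_sum
  intro i _
  exact (diffOn_phK ht he i).mul (by fun_prop)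

lemma BM_mulVec (t K N : ℕ) (q : ℂ) (v : Fin N → ℂ) :
    Matrix.mulVec (BM t K N q) v = Matrix.mulVec (AM t K N q) v + (∑ s, v s) • pv N q := by
  funext r
  simp only [Matrix.mulVec, dotProduct, BM, AM, Matrix.of_apply, Pi.add_apply, Pi.smul_apply,
    smul_eq_mul, Finset.sum_mul, pv]
  rw [← Finset.sum_add_distrib]
  apply Finset.sum_congr rfl
  intro s _
  split_ifs <;> ring

lemma BM_vecMul (t K N : ℕ) (q : ℂ) (v : Fin N → ℂ) :
    Matrix.vecMul v (BM t K N q) = Matrix.vecMul v (AM t K N q) +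
      (∑ r : Fin N, v r * q ^ ((r : ℕ) + 1)) • ov N := by
  funext s
  simp only [Matrix.vecMul, dotProduct, BM, AM, Matrix.of_apply, Pi.add_apply, Pi.smul_apply,
    smul_eq_mul, Finset.sum_mul, ov, mul_one]
  rw [← Finset.sum_add_distrib]
  apply Finset.sum_congr rfl
  intro r _
  split_ifs <;> ring

lemma sum_zK (t K N : ℕ) (q : ℂ) : ∑ s, zK t K N q s = 1 - fK t K N q := by
  have h1 : ∑ s, zK t K N q s = dotProduct (ov N) (zK t K N q) := by
    simp [dotProduct, ov]
  have h2 : 1 - fK t K N q = dotProduct (phK t K N q) (pv N q) := by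
    simp [dotProduct, fK, pv]
  rw [h1, h2, zK, phK, Matrix.dotProduct_mulVec]

lemma AM_zK {t K N : ℕ} (ht : 2 ≤ t) (he : epsK t K ≤ 0.05) {q : ℂ} (hq : ‖q‖ ≤ 0.61) :
    Matrix.mulVec (AM t K N q) (zK t K N q) = fK t K N q • pv N q := by
  have h := BM_mulVec t K N q (zK t K N q)
  rw [zK_spec ht he hq, sum_zK] at h
  have : Matrix.mulVec (AM t K N q) (zK t K N q) = pv N q - (1 - fK t K N q) • pv N q := by
    rw [eq_sub_iff_add_eq]; exact h.symm
  rw [this, sub_smul, one_smul]; abel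

lemma AM_det_ne {t K N : ℕ} (ht : 2 ≤ t) (he : epsK t K ≤ 0.05) {q : ℂ} (hq : ‖q‖ ≤ 0.61)
    (hf : fK t K N q ≠ 0) : (AM t K N q).det ≠ 0 := by
  intro h
  obtain ⟨v, hv, hv0⟩ := Matrix.exists_mulVec_eq_zero_iff.mpr h
  have h1 := BM_mulVec t K N q v
  rw [hv0, zero_add] at h1
  have h2 : v = (∑ s, v s) • zK t K N q := by
    have : Matrix.mulVec (BM t K N q)⁻¹ (Matrix.mulVec (BM t K N q) v) = v := by
      rw [Matrix.mulVec_mulVec, Matrix.nonsing_inv_mul _ (BM_unit ht he hq), Matrix.one_mulVec]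
    rw [h1, Matrix.mulVec_smul] at this
    exact this.symm
  have h3 : (∑ s, v s) = (∑ s, v s) * (1 - fK t K N q) := by
    rw [← sum_zK, Finset.mul_sum]
    conv_lhs => rw [h2]
    rfl
  have h4 : ∑ s, v s = 0 := by
    have : (∑ s, v s) * fK t K N q = 0 := by linear_combination h3
    exact (mul_eq_zero.mp this).resolve_right hf
  rw [h4, zero_smul] at h2
  exact hv h2

lemma AM_det_zero {t K N : ℕ} (ht : 2 ≤ t) (he : epsK t K ≤ 0.05) {q : ℂ} (hq : ‖q‖ ≤ 0.61)
    (hf : fK t K N q = 0) : (AM t K N q).det = 0 := by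
  apply Matrix.exists_mulVec_eq_zero_iff.mp
  refine ⟨zK t K N q, ?_, ?_⟩
  · intro h
    have := sum_zK t K N q
    rw [h, hf] at this
    simp at this
  · rw [AM_zK ht he hq, hf, zero_smul]

lemma BM_conj (t K N : ℕ) (x : ℝ) (r s : Fin N) :
    (starRingEnd ℂ) (BM t K N x r s) = BM t K N x r s := by
  simp only [BM, Matrix.of_apply]
  split_ifs <;> simp

lemma phK_conj {t K N : ℕ} (ht : 2 ≤ t) (he : epsK t K ≤ 0.05) {x : ℝ} (hq : |x| ≤ 0.61)
    (s : Fin N) : (starRingEnd ℂ) (phK t K N x s) = phK t K N x s := by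
  have hq' : ‖(x : ℂ)‖ ≤ 0.61 := by simpa using hq
  have h := phK_spec (N := N) ht he hq'
  have h1 : Matrix.vecMul (fun s => (starRingEnd ℂ) (phK t K N x s)) (BM t K N x) = ov N := by
    funext s
    have h2 := congrArg (starRingEnd ℂ) (congrFun h s)
    simp only [Matrix.vecMul, dotProduct, map_sum, map_mul, BM_conj] at h2 ⊢
    rw [h2]; simp [ov]
  have h3 : (fun s => (starRingEnd ℂ) (phK t K N x s)) = phK t K N x := by
    conv_rhs => rw [phK, ← h1]
    rw [Matrix.vecMul_vecMul, Matrix.mul_nonsing_inv _ (BM_unit ht he hq'), Matrix.vecMul_one]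
  exact congrFun h3 s

lemma zK_conj {t K N : ℕ} (ht : 2 ≤ t) (he : epsK t K ≤ 0.05) {x : ℝ} (hq : |x| ≤ 0.61)
    (s : Fin N) : (starRingEnd ℂ) (zK t K N x s) = zK t K N x s := by
  have hq' : ‖(x : ℂ)‖ ≤ 0.61 := by simpa using hq
  have h := zK_spec (N := N) ht he hq'
  have h1 : Matrix.mulVec (BM t K N x) (fun s => (starRingEnd ℂ) (zK t K N x s)) = pv N x := by
    funext s
    have h2 := congrArg (starRingEnd ℂ) (congrFun h s)
    simp only [Matrix.mulVec, dotProduct, map_sum, map_mul, BM_conj] at h2 ⊢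
    rw [h2]; simp [pv]
  have h3 : (fun s => (starRingEnd ℂ) (zK t K N x s)) = zK t K N x := by
    conv_rhs => rw [zK, ← h1]
    rw [Matrix.mulVec_mulVec, Matrix.nonsing_inv_mul _ (BM_unit ht he hq'), Matrix.one_mulVec]
  exact congrFun h3 s

lemma fK_conj {t K N : ℕ} (ht : 2 ≤ t) (he : epsK t K ≤ 0.05) {x : ℝ} (hq : |x| ≤ 0.61) :
    (starRingEnd ℂ) (fK t K N x) = fK t K N x := by
  unfold fK
  simp only [map_sub, map_one, map_sum, map_mul, phK_conj ht he hq, map_pow, Complex.conj_ofReal]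

lemma fK_zero (t K N : ℕ) : fK t K N 0 = 1 := by simp [fK]

lemma epsK_tendsto {t : ℕ} (ht : 2 ≤ t) : Tendsto (fun K => epsK t K) atTop (nhds 0) := by
  unfold epsK
  exact (tendsto_pow_atTop_nhds_zero_of_lt_one (by norm_num) (by norm_num)).comp
    (Nat.tendsto_div_const_atTop (by omega))

lemma NK_ge {t K : ℕ} (ht : 2 ≤ t) (hK : 1 ≤ K) : K / t ≤ NK t K + 1 := by
  unfold NK
  have h1 : K / t ≤ K / (t - 1) := Nat.div_le_div_left (by omega) (by omega)
  have h2 : K / (t - 1) ≤ (K + t - 2) / (t - 1) := Nat.div_le_div_right (by omega)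
  omega

/-- existence of the zero `q_K` -/
lemma exists_qK {t : ℕ} (ht : 2 ≤ t) {q₀ : ℝ} (hm : 1 / 2 < q₀ ∧ q₀ < 0.6)
    (hroot : ph t q₀ 0 = 0) (huniq : ∀ q : ℂ, ‖q‖ < 0.61 → ph t q 0 = 0 → q = q₀)
    (δ : ℝ) (hδ : 0 < δ) :
    ∀ᶠ K in atTop, ∃ x : ℝ, |x - q₀| ≤ δ ∧ fK t K (NK t K) x = 0 ∧
      deriv (fun q => fK t K (NK t K) q) x ≠ 0 ∧
      ∀ q : ℂ, ‖q‖ ≤ 0.6 → fK t K (NK t K) q = 0 → q = x := by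
  have hev : ∀ η > (0 : ℝ), ∀ᶠ K in atTop, epsK t K ≤ η := fun η hη =>
    ((epsK_tendsto ht).eventually (gt_mem_nhds hη)).mono (fun _ h => h.le)
  refine perturb_zero (F := fun q => ph t q 0) (Fn := fun K q => fK t K (NK t K) q) (R := 0.61)
    (r := 0.6) (q0 := q₀) (by norm_num) (by linarith [hm.1]) hm.2 (differentiableOn_ph0 ht) ?_ ?_ ?_
    hroot huniq (deriv_ph0_ne ht hm.1.le hm.2.le) δ hδ
  · filter_upwards [hev 0.05 (by norm_num)] with K he
    exact diffOn_fK ht he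
  · intro η hη
    filter_upwards [hev 0.05 (by norm_num), hev (η / 3000) (by positivity), eventually_ge_atTop 1]
      with K he he2 hK q hq
    exact (fK_close ht he (NK_ge ht hK) hq.le).trans (by linarith)
  · filter_upwards [hev 0.05 (by norm_num)] with K he x hx
    exact Complex.conj_eq_iff_im.mp (fK_conj ht he hx.le)

/-! ### Part F : nonnegative inverses -/

lemma cont_det {N : ℕ} {S : Set ℝ} {A : ℝ → Matrix (Fin N) (Fin N) ℝ}
    (h : ∀ i j, ContinuousOn (fun q => A q i j) S) :
    ContinuousOn (fun q => (A q).det) S := by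
  simp only [Matrix.det_apply]
  apply continuousOn_finsetSum
  intro σ _
  apply ContinuousOn.const_smul
  apply continuousOn_finsetProd
  intro i _
  exact h _ _

lemma cont_inv {N : ℕ} {S : Set ℝ} {A : ℝ → Matrix (Fin N) (Fin N) ℝ}
    (h : ∀ i j, ContinuousOn (fun q => A q i j) S) (hd : ∀ x ∈ S, (A x).det ≠ 0) (i j : Fin N) :
    ContinuousOn (fun q => (A q)⁻¹ i j) S := by
  simp only [Matrix.inv_def, Matrix.smul_apply, Ring.inverse_eq_inv', smul_eq_mul]
  refine ContinuousOn.mul (ContinuousOn.inv₀ (cont_det h) hd) ?_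
  simp only [Matrix.adjugate_apply]
  apply cont_det
  intro a b
  simp only [Matrix.updateRow_apply]
  split_ifs
  · exact continuousOn_const
  · exact h _ _

lemma inv_nonneg_aux {N : ℕ} (M : ℝ → Matrix (Fin N) (Fin N) ℝ) (b η : ℝ) (hb : 0 ≤ b)
    (hη : 0 < η)
    (hc : ∀ i j, Continuous (fun x => M x i j)) (hM0 : M 0 = 0)
    (hM : ∀ x, 0 ≤ x → ∀ i j, 0 ≤ M x i j)
    (hdet : ∀ x, 0 ≤ x → x ≤ b → (1 - M x).det ≠ 0) (c : Fin N → ℝ) (hcn : ∀ i, η ≤ c i)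
    (i : Fin N) : 0 ≤ (Matrix.mulVec (1 - M b)⁻¹ c) i := by
  have : Nonempty (Fin N) := ⟨i⟩
  set w : ℝ → Fin N → ℝ := fun x => Matrix.mulVec (1 - M x)⁻¹ c with hw
  have hwc : ∀ i, ContinuousOn (fun x => w x i) (Set.Icc 0 b) := by
    intro i
    simp only [hw, Matrix.mulVec, dotProduct]
    apply continuousOn_finsetSum
    intro j _
    refine ContinuousOn.mul (cont_inv ?_ ?_ i j) continuousOn_const
    · intro i j
      simp only [Matrix.sub_apply]
      exact (continuous_const.sub (hc i j)).continuousOn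
    · intro x hx
      exact hdet x hx.1 hx.2
  have hwe : ∀ x ∈ Set.Icc 0 b, ∀ i, w x i = c i + ∑ j, M x i j * w x j := by
    intro x hx i
    have h1 : Matrix.mulVec (1 - M x) (w x) = c := by
      rw [hw]
      simp only [Matrix.mulVec_mulVec]
      rw [Matrix.mul_nonsing_inv _ (hdet x hx.1 hx.2).isUnit, Matrix.one_mulVec]
    rw [Matrix.sub_mulVec, Matrix.one_mulVec] at h1
    have h2 := congrFun h1 i
    simp only [Pi.sub_apply, Matrix.mulVec, dotProduct] at h2
    linarith
  set m : ℝ → ℝ := fun x => Finset.univ.inf' Finset.univ_nonempty (fun i => w x i) with hm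
  have hmc : ContinuousOn m (Set.Icc 0 b) := by
    apply ContinuousOn.finset_inf'_apply
    intro i _
    exact hwc i
  have hstep : ∀ x ∈ Set.Icc 0 b, 0 ≤ m x → η ≤ m x := by
    intro x hx h0
    rw [hm, Finset.le_inf'_iff] at h0 ⊢
    intro i _
    rw [hwe x hx i]
    have : 0 ≤ ∑ j, M x i j * w x j :=
      Finset.sum_nonneg (fun j _ => mul_nonneg (hM x hx.1 i j) (h0 j (Finset.mem_univ _)))
    linarith [hcn i]
  have hm0 : η ≤ m 0 := by
    apply hstep 0 ⟨le_rfl, hb⟩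
    rw [hm, Finset.le_inf'_iff]
    intro i _
    rw [hwe 0 ⟨le_rfl, hb⟩ i, hM0]
    simp
    linarith [hcn i]
  have hmb : 0 ≤ m b := by
    by_contra hneg
    push Not at hneg
    have := intermediate_value_Icc' hb hmc
    obtain ⟨x, hx, hxe⟩ := this (show η / 2 ∈ Set.Icc (m b) (m 0) from ⟨by linarith, by linarith⟩)
    have := hstep x hx (by rw [hxe]; linarith)
    rw [hxe] at this
    linarith
  exact hmb.trans (Finset.inf'_le _ (Finset.mem_univ i))

lemma inv_nonneg_mat {N : ℕ} (M : ℝ → Matrix (Fin N) (Fin N) ℝ) (b : ℝ) (hb : 0 ≤ b)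
    (hc : ∀ i j, Continuous (fun x => M x i j)) (hM0 : M 0 = 0)
    (hM : ∀ x, 0 ≤ x → ∀ i j, 0 ≤ M x i j)
    (hdet : ∀ x, 0 ≤ x → x ≤ b → (1 - M x).det ≠ 0) (c : Fin N → ℝ) (hcn : ∀ i, 0 ≤ c i)
    (i : Fin N) : 0 ≤ (Matrix.mulVec (1 - M b)⁻¹ c) i := by
  set o : Fin N → ℝ := fun _ => 1
  have h : ∀ η > 0, 0 ≤ (Matrix.mulVec (1 - M b)⁻¹ c) i + η * (Matrix.mulVec (1 - M b)⁻¹ o) i := by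
    intro η hη
    have := inv_nonneg_aux M b η hb hη hc hM0 hM hdet (c + η • o)
      (fun i => by simp [o]; linarith [hcn i]) i
    rw [Matrix.mulVec_add, Matrix.mulVec_smul] at this
    simpa using this
  have hlim : Tendsto (fun η : ℝ => (Matrix.mulVec (1 - M b)⁻¹ c) i +
      η * (Matrix.mulVec (1 - M b)⁻¹ o) i) (nhdsWithin 0 (Set.Ioi 0))
      (nhds ((Matrix.mulVec (1 - M b)⁻¹ c) i + 0 * (Matrix.mulVec (1 - M b)⁻¹ o) i)) := by
    apply Tendsto.mono_left _ nhdsWithin_le_nhds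
    exact Continuous.tendsto (by fun_prop) 0
  rw [zero_mul, add_zero] at hlim
  refine ge_of_tendsto hlim ?_
  filter_upwards [self_mem_nhdsWithin] with η hη
  exact h η hη

/-- the real transfer matrix -/
def MR (t K N : ℕ) (x : ℝ) : Matrix (Fin N) (Fin N) ℝ :=
  Matrix.of fun r s : Fin N => x ^ ((r : ℕ) + 1) *
        (if (r : ℕ) + 1 ≤ t * ((s : ℕ) + 1) ∧ t * ((s : ℕ) + 1) ≤ (r : ℕ) + 1 + K
          then 1 else 0)

lemma AM_eq_map (t K N : ℕ) (x : ℝ) :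
    AM t K N x = (1 - MR t K N x).map (algebraMap ℝ ℂ) := by
  ext r s
  simp only [AM, MR, Matrix.of_apply, Matrix.map_apply, Matrix.sub_apply, Matrix.one_apply,
    Complex.coe_algebraMap]
  split_ifs <;> simp

lemma det_MR_ne {t K N : ℕ} (ht : 2 ≤ t) (he : epsK t K ≤ 0.05) {x : ℝ} (hq : |x| ≤ 0.61)
    (hf : fK t K N x ≠ 0) : (1 - MR t K N x).det ≠ 0 := by
  intro h
  apply AM_det_ne ht he (by simpa using hq) hf
  rw [AM_eq_map]
  have := RingHom.map_det (algebraMap ℝ ℂ) (1 - MR t K N x)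
  rw [h, map_zero] at this
  exact this.symm

lemma MR_cont (t K N : ℕ) (i j : Fin N) : Continuous (fun x => MR t K N x i j) := by
  simp only [MR, Matrix.of_apply]; fun_prop

lemma MR_zero (t K N : ℕ) : MR t K N 0 = 0 := by
  ext i j; simp [MR]

lemma MR_nonneg (t K N : ℕ) (x : ℝ) (hx : 0 ≤ x) (i j : Fin N) : 0 ≤ MR t K N x i j := by
  simp only [MR, Matrix.of_apply]
  split_ifs <;> simp
  positivity

lemma super_exists {t K N : ℕ} (ht : 2 ≤ t) (he : epsK t K ≤ 0.05) {b : ℝ} (hb0 : 0 ≤ b)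
    (hb : b ≤ 0.61) (hf : ∀ x : ℝ, 0 ≤ x → x ≤ b → fK t K N x ≠ 0) :
    ∃ w : Fin N → ℝ, (∀ s, 0 ≤ w s) ∧ ∀ s, w s = 1 + ∑ r, MR t K N b r s * w r := by
  have hdet : ∀ x, 0 ≤ x → x ≤ b → (1 - (MR t K N x).transpose).det ≠ 0 := by
    intro x h0 h1
    rw [← Matrix.det_transpose, Matrix.transpose_sub, Matrix.transpose_one,
      Matrix.transpose_transpose]
    exact det_MR_ne ht he (by rw [abs_of_nonneg h0]; linarith) (hf x h0 h1)
  refine ⟨Matrix.mulVec (1 - (MR t K N b).transpose)⁻¹ (fun _ => 1), ?_, ?_⟩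
  · apply inv_nonneg_mat (fun x => (MR t K N x).transpose) b hb0
    · intro i j; exact MR_cont t K N j i
    · simp [MR_zero]
    · intro x hx i j; exact MR_nonneg t K N x hx j i
    · exact hdet
    · intro i; norm_num
  · intro s
    have h1 : Matrix.mulVec (1 - (MR t K N b).transpose)
        (Matrix.mulVec (1 - (MR t K N b).transpose)⁻¹ (fun _ => 1)) = (fun _ => 1) := by
      rw [Matrix.mulVec_mulVec, Matrix.mul_nonsing_inv _ (hdet b hb0 le_rfl).isUnit,
        Matrix.one_mulVec]
    generalize (Matrix.mulVec (1 - (MR t K N b).transpose)⁻¹ (fun _ => (1 : ℝ))) = w at h1 ⊢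
    rw [Matrix.sub_mulVec, Matrix.one_mulVec] at h1
    have h2 := congrFun h1 s
    simp only [Pi.sub_apply, Matrix.mulVec, dotProduct, Matrix.transpose_apply] at h2
    linarith

/-- real part of `fK` is positive before the first zero -/
lemma fK_pos {t K N : ℕ} (ht : 2 ≤ t) (he : epsK t K ≤ 0.05) {b : ℝ} (hb0 : 0 ≤ b)
    (hb : b < 0.61) (hf : ∀ x : ℝ, 0 ≤ x → x ≤ b → fK t K N x ≠ 0) : 0 < (fK t K N b).re := by
  by_contra hneg
  push Not at hneg
  have hc : ContinuousOn (fun x : ℝ => (fK t K N x).re) (Set.Icc 0 b) := by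
    apply Complex.continuous_re.comp_continuousOn
    apply (diffOn_fK (N := N) ht he).continuousOn.comp (f := fun x : ℝ => (x : ℂ))
      Complex.continuous_ofReal.continuousOn
    intro x hx
    rw [mem_ball_zero_iff, Complex.norm_real, Real.norm_eq_abs, abs_of_nonneg hx.1]
    linarith [hx.2]
  have := intermediate_value_Icc' hb0 hc
  obtain ⟨x, hx, hxe⟩ := this (show (0 : ℝ) ∈ Set.Icc _ _ from ⟨hneg, by simp [fK_zero]⟩)
  apply hf x hx.1 hx.2
  have him := Complex.conj_eq_iff_im.mp (fK_conj (N := N) ht he (x := x)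
    (by rw [abs_of_nonneg hx.1]; linarith [hx.2]))
  exact Complex.ext hxe him

lemma zK_nonneg_aux {t K N : ℕ} (ht : 2 ≤ t) (he : epsK t K ≤ 0.05) {b : ℝ} (hb0 : 0 ≤ b)
    (hb : b < 0.61) (hf : ∀ x : ℝ, 0 ≤ x → x ≤ b → fK t K N x ≠ 0) (s : Fin N) :
    0 ≤ (zK t K N b s).re := by
  have habs : |b| ≤ 0.61 := by rw [abs_of_nonneg hb0]; exact hb.le
  have hdet := det_MR_ne (N := N) ht he habs (hf b hb0 le_rfl)
  set z : Fin N → ℝ := fun s => (zK t K N b s).re with hz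
  have hzc : ∀ s, zK t K N b s = (z s : ℂ) := fun s => (Complex.conj_eq_iff_re.mp (zK_conj ht he habs s)).symm
  have hfc : fK t K N b = ((fK t K N b).re : ℂ) := (Complex.conj_eq_iff_re.mp (fK_conj ht he habs)).symm
  have h1 : Matrix.mulVec (1 - MR t K N b) z = fun r : Fin N => (fK t K N b).re * b ^ ((r : ℕ) + 1) := by
    funext r
    have h2 := congrFun (AM_zK (N := N) ht he (q := b) (by simpa using habs)) r
    rw [AM_eq_map, hfc] at h2
    simp only [Matrix.mulVec, dotProduct, Matrix.map_apply, hzc, Pi.smul_apply, pv, smul_eq_mul,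
      Complex.coe_algebraMap] at h2 ⊢
    exact_mod_cast h2
  have h3 : z = Matrix.mulVec (1 - MR t K N b)⁻¹
      (fun r : Fin N => (fK t K N b).re * b ^ ((r : ℕ) + 1)) := by
    rw [← h1, Matrix.mulVec_mulVec, Matrix.nonsing_inv_mul _ hdet.isUnit, Matrix.one_mulVec]
  have h4 := inv_nonneg_mat (MR t K N) b hb0 (MR_cont t K N) (MR_zero t K N)
    (MR_nonneg t K N) (fun x h0 h1 => det_MR_ne ht he (by rw [abs_of_nonneg h0]; linarith) (hf x h0 h1))
    (fun r : Fin N => (fK t K N b).re * b ^ ((r : ℕ) + 1))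
    (fun r => by have := fK_pos ht he hb0 hb hf; positivity) s
  rw [← h3] at h4
  exact h4

lemma zK_nonneg {t K N : ℕ} (ht : 2 ≤ t) (he : epsK t K ≤ 0.05) {b : ℝ} (hb0 : 0 < b)
    (hb : b < 0.61) (hf : ∀ x : ℝ, 0 ≤ x → x < b → fK t K N x ≠ 0) (s : Fin N) :
    0 ≤ (zK t K N b s).re := by
  have hc : ContinuousAt (fun x : ℝ => (zK t K N x s).re) b := by
    apply Complex.continuous_re.continuousAt.comp
    apply ContinuousAt.comp (g := fun q : ℂ => zK t K N q s) (f := fun x : ℝ => (x : ℂ)) _ Complex.continuous_ofReal.continuousAt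
    refine ((diffOn_zK (N := N) ht he s).continuousOn).continuousAt (Metric.isOpen_ball.mem_nhds ?_)
    rw [mem_ball_zero_iff, Complex.norm_real, Real.norm_eq_abs, abs_of_pos hb0]
    exact hb
  have hlim := hc.tendsto.mono_left (nhdsWithin_le_nhds (s := Set.Iio b))
  refine ge_of_tendsto hlim ?_
  have hpos : ∀ᶠ x in nhdsWithin b (Set.Iio b), 0 < x :=
    nhdsWithin_le_nhds (lt_mem_nhds hb0)
  filter_upwards [self_mem_nhdsWithin, hpos] with x hx hx0
  have hx' : x < b := hx
  exact zK_nonneg_aux ht he hx0.le (by linarith) (fun y h0 h1 => hf y h0 (by linarith)) s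

/-! ### Part G : trees -/

def vld (t K : ℕ) : ℕ → List ℕ → Prop
  | s, [] => t * s ≤ K
  | s, r :: l => (1 ≤ r ∧ r ≤ t * s ∧ t * s ≤ r + K) ∧ vld t K r l

def GK {R : Type} [NormedField R] (t K : ℕ) (q : R) : ℕ → List ℕ → R
  | s, [] => if t * s ≤ K then 1 else 0
  | s, r :: l => if 1 ≤ r ∧ r ≤ t * s ∧ t * s ≤ r + K then q ^ r * GK t K q r l else 0

def GLn {R : Type} [NormedField R] (t K : ℕ) (q : R) (n s : ℕ) (l : List ℕ) : R :=
  if l.length < n then GK t K q s l else 0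

section generic
variable {R : Type} [NormedField R]

lemma GK_of_vld {t K : ℕ} {q : R} {l : List ℕ} : ∀ {s : ℕ}, vld t K s l → GK t K q s l = q ^ l.sum := by
  induction l with
  | nil => intro s h; simp only [vld] at h; simp [GK, h]
  | cons a l ih =>
    intro s h
    simp only [vld] at h
    rw [GK, if_pos h.1, ih h.2, List.sum_cons, pow_add]

lemma GK_of_not_vld {t K : ℕ} {q : R} {l : List ℕ} : ∀ {s : ℕ}, ¬ vld t K s l → GK t K q s l = 0 := by
  induction l with
  | nil => intro s h; simp only [vld] at h; simp only [GK, h, if_false]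
  | cons a l ih =>
    intro s h
    simp only [vld] at h
    rw [GK]
    split_ifs with h1
    · rw [ih (fun h2 => h ⟨h1, h2⟩), mul_zero]
    · rfl

lemma vld_lt {t K : ℕ} (ht : 2 ≤ t) {l : List ℕ} : ∀ {s : ℕ}, 1 ≤ s → vld t K s l → s ≤ NK t K := by
  have key : ∀ {s : ℕ}, 1 ≤ s → vld t K s l → (t - 1) * s < K := by
    obtain ⟨u, rfl⟩ : ∃ u, t = u + 1 := ⟨t - 1, by omega⟩
    simp only [Nat.add_sub_cancel]
    induction l with
    | nil => intro s hs h; simp only [vld] at h; nlinarith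
    | cons a l ih =>
      intro s hs h
      simp only [vld] at h
      have h1 := ih h.1.1 h.2
      by_contra h2
      push Not at h2
      have h3 : s ≤ a := by nlinarith [h.1.2.2]
      nlinarith
  intro s hs h
  have h1 := key hs h
  unfold NK
  have : s + 1 ≤ (K + t - 2) / (t - 1) := by
    rw [Nat.le_div_iff_mul_le (by omega)]
    obtain ⟨u, rfl⟩ : ∃ u, t = u + 2 := ⟨t - 2, by omega⟩
    simp only [show u + 2 - 1 = u + 1 by omega] at h1 ⊢
    rw [add_mul, mul_comm s]
    omega
  omega

lemma list_step {N : ℕ} {τ : R} {c : ℕ → R} {H : ℕ → List ℕ → R} {u : ℕ → R}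
    (hH : ∀ r < N, HasSum (H r) (u r)) {G : List ℕ → R} (h0 : G [] = τ)
    (h1 : ∀ a l, G (a :: l) = if 1 ≤ a ∧ a ≤ N then c (a - 1) * H (a - 1) l else 0) :
    HasSum G (τ + ∑ r ∈ Finset.range N, c r * u r) := by
  have hE : ∀ r ∈ Finset.range N, HasSum (fun l : List ℕ => match l with
      | [] => 0
      | a :: l => if a = r + 1 then c r * H r l else 0) (c r * u r) := by
    intro r hr
    have hinj : Function.Injective (fun l : List ℕ => (r + 1) :: l) := List.cons_injective
    rw [← hinj.hasSum_iff]
    · have : ((fun l : List ℕ => match l with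
        | [] => 0
        | a :: l => if a = r + 1 then c r * H r l else 0) ∘ fun l : List ℕ => (r + 1) :: l) =
        fun l => c r * H r l := by
        funext l; simp
      rw [this]
      exact (hH r (Finset.mem_range.mp hr)).mul_left _
    · intro l hl
      match l with
      | [] => rfl
      | a :: l =>
        simp only
        rw [if_neg]
        rintro rfl
        exact hl ⟨l, rfl⟩
  have h2 := hasSum_sum hE
  have h3 : HasSum (fun l : List ℕ => if l = [] then τ else 0) τ := hasSum_ite_eq [] τ
  convert h3.add h2 using 1
  funext l
  match l with
  | [] => simp [h0]
  | a :: l =>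
    rw [h1]
    simp only [reduceCtorEq, if_false, zero_add]
    split_ifs with h
    · rw [Finset.sum_eq_single (a - 1)]
      · rw [if_pos (by omega)]
      · intro b _ hb
        rw [if_neg (by omega)]
      · intro hb; simp at hb; omega
    · symm
      apply Finset.sum_eq_zero
      intro r hr
      simp at hr
      rw [if_neg (by omega)]

end generic

lemma GK_cons {R : Type} [NormedField R] {t K : ℕ} (ht : 2 ≤ t) (q : R) (s a : ℕ) (l : List ℕ) :
    GK t K q (s + 1) (a :: l) = if 1 ≤ a ∧ a ≤ NK t K then
      ((if (a - 1) + 1 ≤ t * (s + 1) ∧ t * (s + 1) ≤ (a - 1) + 1 + K then q ^ (a - 1 + 1) else 0)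
        * GK t K q (a - 1 + 1) l) else 0 := by
  rw [GK]
  by_cases h : 1 ≤ a
  · have ha : a - 1 + 1 = a := by omega
    rw [ha]
    by_cases h2 : a ≤ NK t K
    · rw [if_pos (show 1 ≤ a ∧ a ≤ NK t K from ⟨h, h2⟩)]
      simp only [h, true_and]
      split_ifs <;> simp
    · rw [if_neg (show ¬ (1 ≤ a ∧ a ≤ NK t K) by omega)]
      rw [GK_of_not_vld (fun hv => h2 (vld_lt ht h hv))]
      simp
  · rw [if_neg (by omega), if_neg (by omega)]

lemma GK_nonneg (t K : ℕ) {x : ℝ} (hx : 0 ≤ x) (l : List ℕ) : ∀ s, 0 ≤ GK t K x s l := by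
  induction l with
  | nil => intro s; rw [GK]; split_ifs <;> norm_num
  | cons a l ih =>
    intro s; rw [GK]
    split_ifs
    · exact mul_nonneg (by positivity) (ih a)
    · exact le_rfl

lemma norm_GK (t K : ℕ) (q : ℂ) (l : List ℕ) : ∀ s, ‖GK t K q s l‖ = GK t K ‖q‖ s l := by
  induction l with
  | nil => intro s; simp only [GK]; split_ifs <;> simp
  | cons a l ih =>
    intro s; simp only [GK]
    split_ifs
    · rw [norm_mul, norm_pow, ih]
    · simp

lemma GLn_bound {t K : ℕ} (ht : 2 ≤ t) {x : ℝ} (hx : 0 ≤ x) (w : Fin (NK t K) → ℝ)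
    (hw0 : ∀ s, 0 ≤ w s)
    (hw : ∀ s, w s = 1 + ∑ r, MR t K (NK t K) x r s * w r) (n : ℕ) :
    ∃ u : ℕ → ℝ, ∀ s (hs : s < NK t K), HasSum (GLn t K x n (s + 1)) (u s) ∧ u s ≤ w ⟨s, hs⟩ := by
  induction n with
  | zero =>
    refine ⟨fun _ => 0, fun s hs => ⟨?_, hw0 _⟩⟩
    have : GLn t K x 0 (s + 1) = fun _ => 0 := by funext l; simp [GLn]
    rw [this]; exact hasSum_zero
  | succ n ih =>
    obtain ⟨u, hu⟩ := ih
    refine ⟨fun s => (if t * (s + 1) ≤ K then 1 else 0) + ∑ r ∈ Finset.range (NK t K),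
      (if r + 1 ≤ t * (s + 1) ∧ t * (s + 1) ≤ r + 1 + K then x ^ (r + 1) else 0) * u r, ?_⟩
    intro s hs
    constructor
    · apply list_step (H := fun r => GLn t K x n (r + 1))
        (c := fun r => (if r + 1 ≤ t * (s + 1) ∧ t * (s + 1) ≤ r + 1 + K then x ^ (r + 1) else 0))
        (fun r hr => (hu r hr).1)
      · simp [GLn, GK]
      · intro a l
        simp only [GLn, List.length_cons, add_lt_add_iff_right, GK_cons ht]
        by_cases h : l.length < n
        · simp only [h, if_true]
        · simp [h]
    · rw [hw ⟨s, hs⟩]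
      apply add_le_add
      · split_ifs <;> norm_num
      · rw [← Fin.sum_univ_eq_sum_range (fun r => (if r + 1 ≤ t * (s + 1) ∧ t * (s + 1) ≤ r + 1 + K
          then x ^ (r + 1) else 0) * u r)]
        apply Finset.sum_le_sum
        intro r _
        simp only [MR, Matrix.of_apply]
        have := (hu r r.2).2
        split_ifs
        · rw [mul_one]
          exact mul_le_mul_of_nonneg_left this (by positivity)
        · simp

lemma GK_summable_real {t K : ℕ} (ht : 2 ≤ t) {x : ℝ} (hx : 0 ≤ x) (w : Fin (NK t K) → ℝ)
    (hw0 : ∀ s, 0 ≤ w s)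
    (hw : ∀ s, w s = 1 + ∑ r, MR t K (NK t K) x r s * w r) (s : ℕ) (hs : s < NK t K) :
    Summable (GK t K x (s + 1)) := by
  apply summable_of_sum_le (c := w ⟨s, hs⟩) (fun l => GK_nonneg t K hx l _)
  intro F
  obtain ⟨u, hu⟩ := GLn_bound ht hx w hw0 hw (F.sup List.length + 1)
  obtain ⟨h1, h2⟩ := hu s hs
  refine le_trans ?_ h2
  have h3 : ∑ l ∈ F, GK t K x (s + 1) l = ∑ l ∈ F, GLn t K x (F.sup List.length + 1) (s + 1) l := by
    apply Finset.sum_congr rfl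
    intro l hl
    rw [GLn, if_pos]
    exact Nat.lt_succ_of_le (Finset.le_sup (f := List.length) hl)
  rw [h3]
  refine sum_le_hasSum F (fun l _ => ?_) h1
  rw [GLn]
  split_ifs
  · exact GK_nonneg t K hx l _
  · exact le_rfl

lemma GK_summable {t K : ℕ} (ht : 2 ≤ t) (he : epsK t K ≤ 0.05) {q : ℂ}
    (hq : ‖q‖ ≤ 0.61) (hf : ∀ x : ℝ, 0 ≤ x → x ≤ ‖q‖ → fK t K (NK t K) x ≠ 0)
    (s : ℕ) (hs : s < NK t K) : Summable (GK t K q (s + 1)) := by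
  obtain ⟨w, hw0, hw⟩ := super_exists ht he (norm_nonneg q) hq hf
  apply Summable.of_norm
  simp only [norm_GK]
  exact GK_summable_real ht (norm_nonneg q) w hw0 hw s hs

def tauK (t K N : ℕ) : Fin N → ℂ := fun s => if t * ((s : ℕ) + 1) ≤ K then 1 else 0

/-- the numerator -/
def nuK (t K N : ℕ) (hN : 0 < N) (q : ℂ) : ℂ :=
  (1 + q * Matrix.vecMul (tauK t K N) (BM t K N q)⁻¹ ⟨0, hN⟩) * fK t K N q
    + q * phK t K N q ⟨0, hN⟩ * dotProduct (tauK t K N) (zK t K N q)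

lemma u_formula {t K : ℕ} (ht : 2 ≤ t) (he : epsK t K ≤ 0.05) {q : ℂ}
    (hq : ‖q‖ ≤ 0.61) (hf : ∀ x : ℝ, 0 ≤ x → x ≤ ‖q‖ → fK t K (NK t K) x ≠ 0)
    (hfq : fK t K (NK t K) q ≠ 0) (hN : 0 < NK t K) :
    1 + q * ∑' l, GK t K q 1 l = nuK t K (NK t K) hN q / fK t K (NK t K) q := by
  set u : Fin (NK t K) → ℂ := fun s => ∑' l, GK t K q ((s : ℕ) + 1) l with hu
  have hsum : ∀ r < NK t K, HasSum (GK t K q (r + 1)) (∑' l, GK t K q (r + 1) l) :=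
    fun r hr => (GK_summable ht he hq hf r hr).hasSum
  have h1 : Matrix.vecMul u (AM t K (NK t K) q) = tauK t K (NK t K) := by
    funext s
    have h2 := list_step (N := NK t K) (τ := if t * ((s : ℕ) + 1) ≤ K then 1 else 0)
      (c := fun r => if r + 1 ≤ t * ((s : ℕ) + 1) ∧ t * ((s : ℕ) + 1) ≤ r + 1 + K then q ^ (r + 1) else 0)
      (H := fun r => GK t K q (r + 1)) (u := fun r => ∑' l, GK t K q (r + 1) l) hsum
      (G := GK t K q ((s : ℕ) + 1)) rfl (fun a l => GK_cons ht q s a l)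
    have h3 : u s = _ := h2.tsum_eq
    rw [← Fin.sum_univ_eq_sum_range (fun r => (if r + 1 ≤ t * ((s : ℕ) + 1) ∧ t * ((s : ℕ) + 1) ≤ r + 1 + K
      then q ^ (r + 1) else 0) * ∑' l, GK t K q (r + 1) l)] at h3
    simp only [Matrix.vecMul, dotProduct, AM, Matrix.of_apply, mul_sub, Finset.sum_sub_distrib]
    have h4 : ∑ r : Fin (NK t K), u r * (if r = s then 1 else 0) = u s := by simp
    rw [h4, h3, tauK, add_sub_assoc, add_eq_left, sub_eq_zero]
    apply Finset.sum_congr rfl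
    intro r _
    split_ifs <;> simp [hu, mul_comm]
  have h5 : dotProduct u (pv (NK t K) q) * fK t K (NK t K) q
      = dotProduct (tauK t K (NK t K)) (zK t K (NK t K) q) := by
    rw [← h1, ← Matrix.dotProduct_mulVec, AM_zK ht he hq, dotProduct_smul, smul_eq_mul, mul_comm]
  have h6 := BM_vecMul t K (NK t K) q u
  rw [h1] at h6
  have h7 : u = Matrix.vecMul (tauK t K (NK t K)) (BM t K (NK t K) q)⁻¹ +
      dotProduct u (pv (NK t K) q) • phK t K (NK t K) q := by
    have : Matrix.vecMul (Matrix.vecMul u (BM t K (NK t K) q)) (BM t K (NK t K) q)⁻¹ = u := by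
      rw [Matrix.vecMul_vecMul, Matrix.mul_nonsing_inv _ (BM_unit ht he hq), Matrix.vecMul_one]
    rw [h6, Matrix.add_vecMul, Matrix.smul_vecMul] at this
    exact this.symm
  have h8 := congrFun h7 ⟨0, hN⟩
  simp only [Pi.add_apply, Pi.smul_apply, smul_eq_mul] at h8
  have h9 : ∑' l, GK t K q 1 l = u ⟨0, hN⟩ := rfl
  rw [h9, h8, eq_div_iff hfq, nuK, ← h5]
  ring

/-- indicator series of all trees of width at most `K` -/
def treeF (t K : ℕ) (q : ℂ) : List ℕ → ℂ
  | [] => 1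
  | a :: l => if 1 ≤ a ∧ a ≤ 1 then q * GK t K q (a - 1 + 1) l else 0

lemma treeF_hasSum {t K : ℕ} (ht : 2 ≤ t) (he : epsK t K ≤ 0.05) {q : ℂ}
    (hq : ‖q‖ ≤ 0.61) (hf : ∀ x : ℝ, 0 ≤ x → x ≤ ‖q‖ → fK t K (NK t K) x ≠ 0)
    (hfq : fK t K (NK t K) q ≠ 0) (hN : 0 < NK t K) :
    HasSum (treeF t K q) (nuK t K (NK t K) hN q / fK t K (NK t K) q) := by
  have h2 := list_step (N := 1) (τ := (1 : ℂ)) (c := fun _ => q)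
      (H := fun r => GK t K q (r + 1)) (u := fun r => ∑' l, GK t K q (r + 1) l)
      (fun r hr => (GK_summable ht he hq hf r (by omega)).hasSum)
      (G := treeF t K q) rfl (fun a l => rfl)
  rw [Finset.sum_range_one, zero_add, u_formula ht he hq hf hfq hN] at h2
  exact h2

lemma vld_iff {t K : ℕ} (l : List ℕ) : ∀ s, vld t K s l ↔
    (∀ c ∈ l, 0 < c) ∧ (s :: l).IsChain (fun a b => b ≤ t * a) ∧
      ∀ k ≤ l.length, t * (s :: l).getD k 0 - l.getD k 0 ≤ K := by
  induction l with
  | nil => intro s; simp [vld]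
  | cons a l ih =>
    intro s
    simp only [vld, ih a, List.mem_cons, forall_eq_or_imp, List.isChain_cons_cons, List.length_cons]
    constructor
    · rintro ⟨⟨h1, h2, h3⟩, h4, h5, h6⟩
      refine ⟨⟨h1, h4⟩, ⟨h2, h5⟩, ?_⟩
      intro k hk
      cases k with
      | zero => simp; omega
      | succ k => simpa using h6 k (by omega)
    · rintro ⟨⟨h1, h4⟩, ⟨h2, h5⟩, h6⟩
      refine ⟨⟨h1, h2, ?_⟩, h4, h5, ?_⟩
      · have := h6 0 (by omega); simp at this; omega
      · intro k hk
        simpa using h6 (k + 1) (by omega)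

lemma width_le_iff {t K : ℕ} (hK : 1 ≤ K) (T : CanonicalForest t 1) :
    T.width ≤ K ↔ T.levels = [] ∨ ∃ l, T.levels = 1 :: l ∧ vld t K 1 l := by
  obtain ⟨lev, pos, head, chain⟩ := T
  simp only [CanonicalForest.width, Finset.sup_le_iff, Finset.mem_range, CanonicalForest.height,
    CanonicalForest.leavesAt, CanonicalForest.vertsAt, CanonicalForest.internAt]
  match lev with
  | [] => simp; omega
  | a :: l =>
    have ha : a = 1 := by
      have h1 := pos a (by simp)
      have h2 := head a (by simp)
      omega
    subst ha
    have hch : (1 :: l).IsChain (fun a b => b ≤ t * a) := chain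
    simp only [reduceCtorEq, false_or, List.cons.injEq, true_and, exists_eq_left']
    rw [vld_iff]
    constructor
    · intro h
      refine ⟨fun c hc => pos c (by simp [hc]), hch, fun k hk => ?_⟩
      have := h (k + 1) (by simp; omega)
      simpa using this
    · rintro ⟨_, _, h⟩ k hk
      cases k with
      | zero => simp
      | succ k => 
        have := h k (by simp at hk; omega)
        simpa using this

lemma tree_hasSum {t K : ℕ} (hK : 1 ≤ K) {q a : ℂ} (h : HasSum (treeF t K q) a) :
    HasSum (fun T : {T : CanonicalForest t 1 // T.width ≤ K} =>
                  q ^ (T : CanonicalForest t 1).size) a := by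
  have hinj : Function.Injective
      (fun T : {T : CanonicalForest t 1 // T.width ≤ K} => (T : CanonicalForest t 1).levels) := by
    rintro ⟨⟨l, _, _, _⟩, _⟩ ⟨⟨l', _, _, _⟩, _⟩ h
    simp only at h
    subst h
    rfl
  rw [← hinj.hasSum_iff] at h
  · convert h using 1
    funext T
    rcases (width_le_iff hK T.1).mp T.2 with h1 | ⟨l, h1, h2⟩
    · simp [CanonicalForest.size, h1, treeF]
    · simp only [CanonicalForest.size, h1, treeF, Function.comp]
      rw [if_pos (by omega), GK_of_vld h2]
      simp [pow_add]
  · intro l hl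
    match l with
    | [] =>
      exfalso
      apply hl
      refine ⟨⟨⟨[], by simp, by simp, List.isChain_nil⟩, ?_⟩, rfl⟩
      rw [width_le_iff hK]
      left; rfl
    | a :: l =>
      rw [treeF]
      split_ifs with h1
      · obtain rfl : a = 1 := by omega
        rw [GK_of_not_vld, mul_zero]
        intro hv
        have hv' := (vld_iff l 1).mp hv
        apply hl
        refine ⟨⟨⟨1 :: l, ?_, by simp, hv'.2.1⟩, ?_⟩, rfl⟩
        · simpa using hv'.1
        · rw [width_le_iff hK]
          right; exact ⟨l, rfl, hv⟩
      · rfl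

/-! ### Part H : the eigenvector and the pole -/

/-- the properties of the (normalized) right eigenvector -/
structure EigV (t K N : ℕ) (x : ℝ) (z : ℕ → ℝ) : Prop where
  nonneg : ∀ s, 0 ≤ z s
  out : ∀ s, N ≤ s → z s = 0
  sum : ∑ s ∈ Finset.range N, z s = 1
  eq : ∀ r, r < N → z r = x ^ (r + 1) * ∑ s ∈ Finset.range N,
    (if r + 1 ≤ t * (s + 1) ∧ t * (s + 1) ≤ r + 1 + K then z s else 0)

lemma eigV_exists {t K N : ℕ} (ht : 2 ≤ t) (he : epsK t K ≤ 0.05) {b : ℝ} (hb0 : 0 < b)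
    (hb : b < 0.61) (hf : ∀ x : ℝ, 0 ≤ x → x < b → fK t K N x ≠ 0) (hfb : fK t K N b = 0) :
    ∃ z : ℕ → ℝ, EigV t K N b z ∧ ∀ s : Fin N, zK t K N b s = z s := by
  have habs : |b| ≤ 0.61 := by rw [abs_of_pos hb0]; exact hb.le
  set z : ℕ → ℝ := fun s => if h : s < N then (zK t K N b ⟨s, h⟩).re else 0 with hz
  have hzs : ∀ s : Fin N, zK t K N b s = z s := by
    intro s
    rw [hz]
    simp only [s.2, dif_pos]
    exact (Complex.conj_eq_iff_re.mp (zK_conj ht he habs s)).symm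
  refine ⟨z, ⟨?_, ?_, ?_, ?_⟩, hzs⟩
  · intro s
    rw [hz]
    simp only
    split_ifs with h
    · exact zK_nonneg ht he hb0 hb hf _
    · exact le_rfl
  · intro s hs
    rw [hz]
    simp only
    rw [dif_neg (by omega)]
  · have := sum_zK t K N b
    rw [hfb, sub_zero] at this
    simp only [hzs] at this
    rw [← Fin.sum_univ_eq_sum_range]
    exact_mod_cast this
  · intro r hr
    have h := congrFun (AM_zK (N := N) ht he (q := b) (by simpa using habs)) ⟨r, hr⟩
    rw [hfb, zero_smul] at h
    simp only [Matrix.mulVec, dotProduct, AM, Matrix.of_apply, sub_mul, Finset.sum_sub_distrib, hzs] at h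
    simp only [ite_mul, one_mul, zero_mul, Finset.sum_ite_eq, Finset.mem_univ, if_true,
      Pi.zero_apply, sub_eq_zero] at h
    rw [Finset.mul_sum, ← Fin.sum_univ_eq_sum_range (fun s => b ^ (r + 1) *
      (if r + 1 ≤ t * (s + 1) ∧ t * (s + 1) ≤ r + 1 + K then z s else 0))]
    have h2 : ((z r : ℝ) : ℂ) = ((∑ s : Fin N, b ^ (r + 1) *
      (if r + 1 ≤ t * ((s : ℕ) + 1) ∧ t * ((s : ℕ) + 1) ≤ r + 1 + K then z s else 0) : ℝ) : ℂ) := by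
      rw [h]
      push_cast
      apply Finset.sum_congr rfl
      intro s _
      split_ifs <;> simp
    exact_mod_cast h2

namespace EigV
variable {t K N : ℕ} {x : ℝ} {z : ℕ → ℝ}

lemma inner_le (h : EigV t K N x z) (P : ℕ → Prop) [DecidablePred P] :
    ∑ s ∈ Finset.range N, (if P s then z s else 0) ≤ 1 := by
  rw [← h.sum]
  apply Finset.sum_le_sum
  intro s _
  split_ifs
  · exact le_rfl
  · exact h.nonneg s

lemma le_pow (h : EigV t K N x z) (hx : 0 ≤ x) (r : ℕ) : z r ≤ x ^ (r + 1) := by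
  by_cases hr : r < N
  · rw [h.eq r hr]
    exact mul_le_of_le_one_right (by positivity) (h.inner_le _)
  · rw [h.out r (by omega)]; positivity

lemma tail_le (h : EigV t K N x z) (hx : 0 ≤ x) (hx1 : x < 1) (m : ℕ) :
    ∑ s ∈ Finset.range N, (if m ≤ s then z s else 0) ≤ x ^ (m + 1) / (1 - x) := by
  refine le_trans (Finset.sum_le_sum fun s _ => ?_) (geom_ite_le hx hx1 m N)
  split_ifs
  · exact h.le_pow hx s
  · exact le_rfl

lemma head_ge (h : EigV t K N x z) (hx : 0 ≤ x) (hx1 : x ≤ 0.6) (m : ℕ) :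
    1 - 1.5 * 0.6 ^ m ≤ ∑ s ∈ Finset.range N, (if s < m then z s else 0) := by
  have h1 := h.tail_le hx (by linarith) m
  have h2 : x ^ (m + 1) / (1 - x) ≤ 1.5 * 0.6 ^ m := by
    have : x ^ (m + 1) ≤ 0.6 ^ (m + 1) := by gcongr
    rw [div_le_iff₀ (by linarith)]
    have h3 : (0 : ℝ) < 0.6 ^ m := by positivity
    rw [pow_succ (0.6 : ℝ)] at this
    nlinarith
  have h4 : ∑ s ∈ Finset.range N, (if s < m then z s else 0) +
      ∑ s ∈ Finset.range N, (if m ≤ s then z s else 0) = 1 := by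
    rw [← h.sum, ← Finset.sum_add_distrib]
    apply Finset.sum_congr rfl
    intro s _
    split_ifs <;> first | (exfalso; omega) | simp
  linarith

end EigV

lemma pole_form {t K : ℕ} (ht : 2 ≤ t) (he : epsK t K ≤ 0.00005) (hK : 1 ≤ K) (hN : 0 < NK t K)
    {x : ℝ} (hx0 : 0 < x) (hx : x < 0.6) (hfx : fK t K (NK t K) x = 0)
    (hd : deriv (fun q => fK t K (NK t K) q) x ≠ 0)
    (hu : ∀ q : ℂ, ‖q‖ ≤ 0.6 → fK t K (NK t K) q = 0 → q = x)
    {z : ℕ → ℝ} (hz : EigV t K (NK t K) x z) (hzs : ∀ s : Fin (NK t K), zK t K (NK t K) x s = z s) :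
    ∃ g : ℂ → ℂ,
            AnalyticOnNhd ℂ g (Metric.closedBall (0 : ℂ) 0.6) ∧
            g (x : ℂ) ≠ 0 ∧
            ∀ q : ℂ, ‖q‖ < x →
              HasSum
                (fun T : {T : CanonicalForest t 1 // T.width ≤ K} =>
                  q ^ (T : CanonicalForest t 1).size)
                (g q / ((x : ℂ) - q)) := by
  have he' : epsK t K ≤ 0.05 := he.trans (by norm_num)
  set N := NK t K with hNdef
  set f : ℂ → ℂ := fun q => fK t K N q with hfdef
  have hfd : DifferentiableOn ℂ f (Metric.ball 0 0.61) := diffOn_fK ht he'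
  have hxb : (x : ℂ) ∈ Metric.ball (0 : ℂ) 0.61 := by
    rw [mem_ball_zero_iff, Complex.norm_real, Real.norm_eq_abs, abs_of_pos hx0]; linarith
  have hds : DifferentiableOn ℂ (dslope f x) (Metric.ball 0 0.61) :=
    (Complex.differentiableOn_dslope (Metric.isOpen_ball.mem_nhds hxb)).mpr hfd
  have hdsm : ∀ q, (q - x) * dslope f x q = f q := by
    intro q
    have := sub_smul_dslope f (x : ℂ) q
    rw [smul_eq_mul] at this
    rw [this]
    have : f x = 0 := hfx
    rw [this, sub_zero]
  have hdsne : ∀ q : ℂ, ‖q‖ ≤ 0.6 → dslope f x q ≠ 0 := by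
    intro q hq h0
    by_cases hqx : q = x
    · rw [hqx, dslope_same] at h0
      exact hd h0
    · apply hqx
      apply hu q hq
      have := hdsm q
      rw [h0, mul_zero] at this
      exact this.symm
  have hnu : DifferentiableOn ℂ (nuK t K N hN) (Metric.ball 0 0.61) := by
    unfold nuK
    refine DifferentiableOn.add (DifferentiableOn.mul ?_ hfd) (DifferentiableOn.mul ?_ ?_)
    · exact (differentiableOn_const _).add (differentiableOn_id.mul (diffOn_vecMul ht he' _ _))
    · exact differentiableOn_id.mul (diffOn_phK ht he' _)
    · simp only [dotProduct]
      apply DifferentiableOn.fun_sum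
      intro i _
      exact (diffOn_zK ht he' i).const_mul _
  have hsub : Metric.closedBall (0 : ℂ) 0.6 ⊆ Metric.ball 0 0.61 := by
    apply Metric.closedBall_subset_ball; norm_num
  refine ⟨fun q => nuK t K N hN q / (-dslope f x q), ?_, ?_, ?_⟩
  · refine AnalyticOnNhd.div ((hnu.analyticOnNhd Metric.isOpen_ball).mono hsub)
      (((hds.analyticOnNhd Metric.isOpen_ball).mono hsub).neg) ?_
    intro q hq
    exact neg_ne_zero.mpr (hdsne q (by simpa using hq))
  · have hxn : ‖(x : ℂ)‖ ≤ 0.6 := by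
      rw [Complex.norm_real, Real.norm_eq_abs, abs_of_pos hx0]; exact hx.le
    refine div_ne_zero ?_ (neg_ne_zero.mpr (hdsne x hxn))
    rw [nuK, hfx, mul_zero, zero_add]
    refine mul_ne_zero (mul_ne_zero ?_ ?_) ?_
    · exact_mod_cast hx0.ne'
    · have h1 := norm_ph_sub_one ht hxn 1 le_rfl
      have h2 := phK_close (N := N) ht he' (NK_ge ht hK) (hxn.trans (by norm_num)) ⟨0, hN⟩
      simp only [zero_add, pow_one] at h2
      intro h0
      rw [h0, sub_zero] at h2
      have h3 : ‖(1 : ℂ)‖ ≤ ‖ph t x 1‖ + ‖ph t x 1 - 1‖ := by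
        have := norm_sub_le (ph t x 1) (ph t x 1 - 1)
        simpa using this
      rw [norm_one] at h3
      norm_num at h2 he h1
      linarith
    · have h1 : dotProduct (tauK t K N) (zK t K N x) =
        ((∑ s ∈ Finset.range N, (if s < K / t then z s else 0) : ℝ) : ℂ) := by
        rw [← Fin.sum_univ_eq_sum_range (fun s => if s < K / t then z s else 0)]
        push_cast
        rw [dotProduct]
        apply Finset.sum_congr rfl
        intro s _
        rw [hzs, tauK]
        have : t * ((s : ℕ) + 1) ≤ K ↔ (s : ℕ) < K / t := by
          rw [Nat.lt_iff_add_one_le, Nat.le_div_iff_mul_le (by omega), mul_comm]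
        simp only [this]
        split_ifs <;> simp
      rw [h1]
      have h2 := hz.head_ge hx0.le hx.le (K / t)
      have h3 : (0.6 : ℝ) ^ (K / t) ≤ epsK t K := by
        unfold epsK; gcongr; norm_num
      have h4 : (0 : ℝ) < ∑ s ∈ Finset.range N, (if s < K / t then z s else 0) := by
        norm_num at he h2 h3
        linarith
      exact_mod_cast h4.ne'
  · intro q hq
    have hq6 : ‖q‖ ≤ 0.6 := by linarith
    have hqx : q - x ≠ 0 := by
      intro h
      rw [sub_eq_zero] at h
      rw [h, Complex.norm_real, Real.norm_eq_abs, abs_of_pos hx0] at hq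
      exact lt_irrefl _ hq
    have hfq : fK t K N q ≠ 0 := by
      rw [show fK t K N q = f q from rfl, ← hdsm q]
      exact mul_ne_zero hqx (hdsne q hq6)
    have hf : ∀ y : ℝ, 0 ≤ y → y ≤ ‖q‖ → fK t K N y ≠ 0 := by
      intro y h0 h1 h2
      have := hu y (by rw [Complex.norm_real, Real.norm_eq_abs, abs_of_nonneg h0]; linarith) h2
      have : y = x := by exact_mod_cast this
      linarith
    have h1 := tree_hasSum hK (treeF_hasSum ht he' (hq6.trans (by norm_num)) hf hfq hN)
    have h2 : nuK t K N hN q / (-dslope f x q) / ((x : ℂ) - q) = nuK t K N hN q / fK t K N q := by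
      rw [show fK t K N q = f q from rfl, ← hdsm q, div_div]
      congr 1
      ring
    rw [h2]
    exact h1

/-! ### Part I : pairing estimates -/

structure PhV (t : ℕ) (q : ℝ) (φ : ℕ → ℝ) : Prop where
  lower : ∀ s, 0.2 ≤ φ s
  upper : ∀ s, φ s ≤ 2
  eq : ∀ s, φ s = ∑ r ∈ Finset.range (t * (s + 1)), φ r * q ^ (r + 1)

lemma phV_exists {t : ℕ} (ht : 2 ≤ t) {q : ℝ} (hq0 : 0 < q) (hq : q ≤ 0.6) (hroot : ph t q 0 = 0) :
    PhV t q (fun s => (ph t q (s + 1)).re) := by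
  have hqn : ‖(q : ℂ)‖ ≤ 0.6 := by
    rw [Complex.norm_real, Real.norm_eq_abs, abs_of_pos hq0]; exact hq
  have hqn' : ‖(q : ℂ)‖ ≤ 0.61 := hqn.trans (by norm_num)
  have h1 : ∀ s, |(ph t q (s + 1)).re - 1| ≤ 0.78 := by
    intro s
    have h := norm_ph_sub_one ht hqn (s + 1) (by omega)
    have h2 := Complex.abs_re_le_norm (ph t q (s + 1) - 1)
    rw [Complex.sub_re, Complex.one_re] at h2
    exact h2.trans h
  refine ⟨?_, ?_, ?_⟩
  · intro s; have := abs_le.mp (h1 s); norm_num at this ⊢; linarith [this.1]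
  · intro s; have := abs_le.mp (h1 s); norm_num at this ⊢; linarith [this.2]
  · intro s
    have h2 := (ph_rec ht hqn' 0)
    have h3 := (ph_rec ht hqn' (s + 1))
    rw [hroot] at h2
    simp only [mul_zero, zero_add, sub_zero] at h2
    have h4 := h2.summable.sum_add_tsum_nat_add (t * (s + 1))
    rw [h2.tsum_eq] at h4
    have h5 : ∀ k, ph t (q : ℂ) (k + t * (s + 1) + 1) * (q : ℂ) ^ (k + t * (s + 1) + 1) =
      ph t q (t * (s + 1) + k + 1) * (q : ℂ) ^ (t * (s + 1) + k + 1) := by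
      intro k; rw [add_comm k]
    simp only [h5, h3.tsum_eq] at h4
    have h6 : ph t q (s + 1) = ∑ r ∈ Finset.range (t * (s + 1)), ph t (q : ℂ) (r + 1) * (q : ℂ) ^ (r + 1) := by
      linear_combination -h4
    rw [h6, Complex.re_sum]
    apply Finset.sum_congr rfl
    intro r _
    rw [← ph_re]
    norm_cast

/-- the defect -/
def defect (t K N : ℕ) (q : ℝ) (φ : ℕ → ℝ) (s : ℕ) : ℝ :=
  ∑ r ∈ Finset.range (t * (s + 1)), φ r * q ^ (r + 1) -
  ∑ r ∈ Finset.range N, (if r + 1 ≤ t * (s + 1) ∧ t * (s + 1) ≤ r + 1 + K then φ r * q ^ (r + 1) else 0)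

lemma defect_eq (t K N : ℕ) (q : ℝ) (φ : ℕ → ℝ) (s : ℕ) :
    defect t K N q φ s = ∑ r ∈ Finset.range (t * (s + 1)),
      (if r < N ∧ t * (s + 1) ≤ r + 1 + K then 0 else φ r * q ^ (r + 1)) := by
  unfold defect
  have : ∑ r ∈ Finset.range N, (if r + 1 ≤ t * (s + 1) ∧ t * (s + 1) ≤ r + 1 + K then φ r * q ^ (r + 1) else 0)
    = ∑ r ∈ Finset.range (t * (s + 1)), (if r < N ∧ t * (s + 1) ≤ r + 1 + K then φ r * q ^ (r + 1) else 0) := by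
    rw [← Finset.sum_filter, ← Finset.sum_filter]
    apply Finset.sum_congr _ (fun _ _ => rfl)
    ext r
    simp only [Finset.mem_filter, Finset.mem_range]
    omega
  rw [this, ← Finset.sum_sub_distrib]
  apply Finset.sum_congr rfl
  intro r _
  split_ifs <;> simp

section
variable {t K N : ℕ} {x q : ℝ} {z φ : ℕ → ℝ}

def Sz (t K N : ℕ) (z : ℕ → ℝ) (r : ℕ) : ℝ := ∑ s ∈ Finset.range N,
    (if r + 1 ≤ t * (s + 1) ∧ t * (s + 1) ≤ r + 1 + K then z s else 0)

lemma pairing (hz : EigV t K N x z) (hφ : PhV t q φ) :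
    ∑ r ∈ Finset.range N, φ r * (x ^ (r + 1) - q ^ (r + 1)) * Sz t K N z r =
      ∑ s ∈ Finset.range N, z s * defect t K N q φ s := by
  have h1 : ∑ r ∈ Finset.range N, φ r * (x ^ (r + 1) - q ^ (r + 1)) * Sz t K N z r =
      ∑ r ∈ Finset.range N, z r * φ r - ∑ r ∈ Finset.range N, φ r * q ^ (r + 1) * Sz t K N z r := by
    rw [← Finset.sum_sub_distrib]
    apply Finset.sum_congr rfl
    intro r hr
    have : z r = x ^ (r + 1) * Sz t K N z r := hz.eq r (Finset.mem_range.mp hr)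
    rw [this]; ring
  have h2 : ∑ s ∈ Finset.range N, z s * defect t K N q φ s = ∑ s ∈ Finset.range N, z s * φ s -
      ∑ s ∈ Finset.range N, z s * ∑ r ∈ Finset.range N, (if r + 1 ≤ t * (s + 1) ∧ t * (s + 1) ≤ r + 1 + K then φ r * q ^ (r + 1) else 0) := by
    rw [← Finset.sum_sub_distrib]
    apply Finset.sum_congr rfl
    intro s _
    rw [defect, ← hφ.eq s]; ring
  rw [h1, h2]
  congr 1
  simp only [Sz, Finset.mul_sum]
  rw [Finset.sum_comm]
  apply Finset.sum_congr rfl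
  intro s _
  apply Finset.sum_congr rfl
  intro r _
  split_ifs <;> ring

lemma defect_term_nonneg (hφ : PhV t q φ) (hq : 0 ≤ q) (r : ℕ) : 0 ≤ φ r * q ^ (r + 1) := by
  have := hφ.lower r
  have h : 0 ≤ φ r := le_trans (by norm_num) this
  positivity

lemma defect_nonneg (hφ : PhV t q φ) (hq : 0 ≤ q) (s : ℕ) : 0 ≤ defect t K N q φ s := by
  rw [defect_eq]
  apply Finset.sum_nonneg
  intro r _
  split_ifs
  · exact le_rfl
  · exact defect_term_nonneg hφ hq r

lemma defect_lower (hφ : PhV t q φ) (hq : 0 ≤ q) (s : ℕ) (hs : K + 1 < t * (s + 1)) :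
    0.2 * q ≤ defect t K N q φ s := by
  rw [defect_eq]
  have h := Finset.single_le_sum (f := fun r => (if r < N ∧ t * (s + 1) ≤ r + 1 + K then 0 else φ r * q ^ (r + 1)))
    (s := Finset.range (t * (s + 1))) (fun r _ => by
      split_ifs
      · exact le_rfl
      · exact defect_term_nonneg hφ hq r) (Finset.mem_range.mpr (show 0 < t * (s + 1) by omega))
  refine le_trans ?_ h
  rw [if_neg (by omega)]
  have := hφ.lower 0
  rw [zero_add, pow_one]
  exact mul_le_mul_of_nonneg_right this hq

lemma defect_upper (hφ : PhV t q φ) (hq : 0 ≤ q) (hq6 : q ≤ 0.6) (s : ℕ) :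
    defect t K N q φ s ≤ 5 * q ^ (N + 1) + (if K + 1 < t * (s + 1) then 3 else 0) := by
  rw [defect_eq]
  have hq1 : q < 1 := by linarith
  have h1 : ∑ r ∈ Finset.range (t * (s + 1)),
      (if r < N ∧ t * (s + 1) ≤ r + 1 + K then 0 else φ r * q ^ (r + 1)) ≤
      ∑ r ∈ Finset.range (t * (s + 1)), (2 * (if N ≤ r then q ^ (r + 1) else 0) +
        (if K + 1 < t * (s + 1) then 2 else 0) * (if 0 ≤ r then q ^ (r + 1) else 0)) := by
    apply Finset.sum_le_sum
    intro r _
    have h2 : φ r * q ^ (r + 1) ≤ 2 * q ^ (r + 1) :=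
      mul_le_mul_of_nonneg_right (hφ.upper r) (by positivity)
    have h3 : 0 ≤ q ^ (r + 1) := by positivity
    simp only [Nat.zero_le, if_true]
    split_ifs <;> first | linarith | (exfalso; omega)
  refine h1.trans ?_
  rw [Finset.sum_add_distrib, ← Finset.mul_sum, ← Finset.mul_sum]
  have hi : 1 / (1 - q) ≤ 2.5 := by
    rw [div_le_iff₀ (by linarith)]; linarith
  have g1 := geom_ite_le hq hq1 N (t * (s + 1))
  have g2 := geom_ite_le hq hq1 0 (t * (s + 1))
  have e1 : q ^ (N + 1) / (1 - q) ≤ 2.5 * q ^ (N + 1) := by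
    rw [div_eq_mul_one_div, mul_comm]
    exact mul_le_mul_of_nonneg_right hi (by positivity)
  have e2 : q ^ (0 + 1) / (1 - q) ≤ 1.5 := by
    rw [div_le_iff₀ (by linarith)]; norm_num; linarith
  apply add_le_add
  · linarith
  · split_ifs
    · linarith
    · simp

lemma Sz_nonneg (hz : EigV t K N x z) (r : ℕ) : 0 ≤ Sz t K N z r := by
  apply Finset.sum_nonneg
  intro s _
  split_ifs
  · exact hz.nonneg s
  · exact le_rfl

lemma Sz_zero_ge (ht : 2 ≤ t) (hz : EigV t K N x z) (hx0 : 0 ≤ x) (hx : x ≤ 0.6)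
    (hs : (0.6 : ℝ) ^ (K / t) ≤ 0.1) : 1 / 2 ≤ Sz t K N z 0 := by
  have h := hz.head_ge hx0 hx (K / t)
  have h2 : ∑ s ∈ Finset.range N, (if s < K / t then z s else 0) ≤ Sz t K N z 0 := by
    apply Finset.sum_le_sum
    intro s _
    have h3 := hz.nonneg s
    split_ifs with a b
    · exact le_rfl
    · exfalso
      apply b
      rw [Nat.lt_iff_add_one_le, Nat.le_div_iff_mul_le (by omega), mul_comm] at a
      constructor
      · nlinarith
      · omega
    · exact h3
    · exact le_rfl
  linarith

lemma qK_ge (ht : 2 ≤ t) (hz : EigV t K N x z) (hφ : PhV t q φ) (hx0 : 0 < x) (hx : x ≤ 0.6)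
    (hs : (0.6 : ℝ) ^ (K / t) ≤ 0.1) (hN : 0 < N) (hq : 0 < q) : q ≤ x := by
  by_contra hlt
  push Not at hlt
  have hp := pairing hz hφ
  have h1 : 0 ≤ ∑ s ∈ Finset.range N, z s * defect t K N q φ s :=
    Finset.sum_nonneg (fun s _ => mul_nonneg (hz.nonneg s) (defect_nonneg hφ hq.le s))
  have h2 : ∑ r ∈ Finset.range N, φ r * (x ^ (r + 1) - q ^ (r + 1)) * Sz t K N z r < 0 := by
    have hterm : ∀ r, φ r * (x ^ (r + 1) - q ^ (r + 1)) * Sz t K N z r ≤ 0 := by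
      intro r
      have a : x ^ (r + 1) ≤ q ^ (r + 1) := by gcongr
      have b : 0 ≤ φ r := le_trans (by norm_num) (hφ.lower r)
      have c := Sz_nonneg hz r
      have : φ r * (x ^ (r + 1) - q ^ (r + 1)) ≤ 0 :=
        mul_nonpos_of_nonneg_of_nonpos b (by linarith)
      exact mul_nonpos_of_nonpos_of_nonneg this c
    apply Finset.sum_neg' (fun r _ => hterm r)
    refine ⟨0, Finset.mem_range.mpr hN, ?_⟩
    have a := Sz_zero_ge ht hz hx0.le hx hs
    have b : 0 < φ 0 := lt_of_lt_of_le (by norm_num) (hφ.lower 0)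
    rw [zero_add, pow_one, pow_one]
    have : φ 0 * (x - q) < 0 := mul_neg_of_pos_of_neg b (by linarith)
    exact mul_neg_of_neg_of_pos this (by linarith)
  linarith

lemma arith_geom_le (n : ℕ) : ∑ r ∈ Finset.range n, ((r : ℝ) + 1) * 0.6 ^ r ≤ 6.25 := by
  have : ∑ r ∈ Finset.range n, ((r : ℝ) + 1) * 0.6 ^ r = 6.25 - (6.25 + 2.5 * n) * 0.6 ^ n := by
    induction n with
    | zero => norm_num
    | succ n ih =>
      rw [Finset.sum_range_succ, ih, pow_succ]
      push_cast
      ring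
  rw [this]
  have : (0 : ℝ) ≤ (6.25 + 2.5 * n) * 0.6 ^ n := by positivity
  linarith

lemma pow_diff_le (hq : 0 ≤ q) (hqx : q ≤ x) (hx : x ≤ 0.6) (r : ℕ) :
    x ^ (r + 1) - q ^ (r + 1) ≤ (((r : ℝ) + 1) * 0.6 ^ r) * (x - q) := by
  induction r with
  | zero => norm_num
  | succ r ih =>
    have h1 : x ^ (r + 1 + 1) - q ^ (r + 1 + 1) = x ^ (r + 1) * (x - q) + q * (x ^ (r + 1) - q ^ (r + 1)) := by
      ring
    rw [h1]
    have h2 : x ^ (r + 1) ≤ 0.6 ^ (r + 1) := by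
      have : 0 ≤ x := by linarith
      gcongr
    have h3 : q * (x ^ (r + 1) - q ^ (r + 1)) ≤ 0.6 * ((((r : ℝ) + 1) * 0.6 ^ r) * (x - q)) := by
      have h0 : 0 ≤ x ^ (r + 1) - q ^ (r + 1) := by
        have : q ^ (r + 1) ≤ x ^ (r + 1) := by gcongr
        linarith
      have : q ≤ 0.6 := by linarith
      gcongr
    have h4 : x ^ (r + 1) * (x - q) ≤ 0.6 ^ (r + 1) * (x - q) :=
      mul_le_mul_of_nonneg_right h2 (by linarith)
    push_cast
    calc _ ≤ 0.6 ^ (r + 1) * (x - q) + 0.6 * ((((r : ℝ) + 1) * 0.6 ^ r) * (x - q)) := add_le_add h4 h3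
      _ = _ := by rw [pow_succ]; ring

lemma lhs_upper (hz : EigV t K N x z) (hφ : PhV t q φ) (hq : 0 ≤ q) (hqx : q ≤ x) (hx : x ≤ 0.6) :
    ∑ r ∈ Finset.range N, φ r * (x ^ (r + 1) - q ^ (r + 1)) * Sz t K N z r ≤ 12.5 * (x - q) := by
  calc _ ≤ ∑ r ∈ Finset.range N, 2 * ((((r : ℝ) + 1) * 0.6 ^ r) * (x - q)) * 1 := by
        apply Finset.sum_le_sum
        intro r _
        have a := pow_diff_le hq hqx hx r
        have b : 0 ≤ φ r := le_trans (by norm_num) (hφ.lower r)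
        have c := hφ.upper r
        have d := Sz_nonneg hz r
        have e : Sz t K N z r ≤ 1 := hz.inner_le _
        have f : 0 ≤ x ^ (r + 1) - q ^ (r + 1) := by
          have : q ^ (r + 1) ≤ x ^ (r + 1) := by gcongr
          linarith
        gcongr
    _ = (∑ r ∈ Finset.range N, ((r : ℝ) + 1) * 0.6 ^ r) * (2 * (x - q)) := by
        rw [Finset.sum_mul]
        apply Finset.sum_congr rfl
        intro r _; ring
    _ ≤ 6.25 * (2 * (x - q)) := mul_le_mul_of_nonneg_right (arith_geom_le N) (by linarith)
    _ = _ := by ring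

lemma lhs_lower (ht : 2 ≤ t) (hz : EigV t K N x z) (hφ : PhV t q φ) (hq : 0 ≤ q) (hqx : q ≤ x) (hx : x ≤ 0.6)
    (hs : (0.6 : ℝ) ^ (K / t) ≤ 0.1) (hN : 0 < N) :
    0.1 * (x - q) ≤ ∑ r ∈ Finset.range N, φ r * (x ^ (r + 1) - q ^ (r + 1)) * Sz t K N z r := by
  have h := Finset.single_le_sum (f := fun r => φ r * (x ^ (r + 1) - q ^ (r + 1)) * Sz t K N z r)
    (s := Finset.range N) (fun r _ => by
        have b : 0 ≤ φ r := le_trans (by norm_num) (hφ.lower r)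
        have d := Sz_nonneg hz r
        have f : 0 ≤ x ^ (r + 1) - q ^ (r + 1) := by
          have : q ^ (r + 1) ≤ x ^ (r + 1) := by gcongr
          linarith
        positivity) (Finset.mem_range.mpr hN)
  refine le_trans ?_ h
  have a := Sz_zero_ge ht hz (by linarith) hx hs
  have b := hφ.lower 0
  simp only [zero_add, pow_one]
  have c : 0 ≤ x - q := by linarith
  calc 0.1 * (x - q) = 0.2 * (x - q) * (1 / 2) := by ring
    _ ≤ _ := by gcongr

/-- `x - q` is at least a multiple of one `z` coordinate -/
lemma diff_lower (hz : EigV t K N x z) (hφ : PhV t q φ) (hq : 1 / 2 ≤ q) (hqx : q ≤ x) (hx : x ≤ 0.6)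
    (s : ℕ) (hsN : s < N) (hs : K + 1 < t * (s + 1)) : 0.008 * z s ≤ x - q := by
  have h1 := lhs_upper hz hφ (by linarith) hqx hx
  rw [pairing hz hφ] at h1
  have h2 := Finset.single_le_sum (f := fun s => z s * defect t K N q φ s)
    (s := Finset.range N) (fun s _ => mul_nonneg (hz.nonneg s) (defect_nonneg hφ (by linarith) s))
    (Finset.mem_range.mpr hsN)
  have h3 := defect_lower (N := N) hφ (by linarith) s hs
  have h4 : z s * 0.1 ≤ z s * defect t K N q φ s :=
    mul_le_mul_of_nonneg_left (by linarith) (hz.nonneg s)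
  linarith

def Zt (N : ℕ) (z : ℕ → ℝ) (m : ℕ) : ℝ := ∑ s ∈ Finset.range N, (if m ≤ s then z s else 0)

lemma diff_upper (ht : 2 ≤ t) (hz : EigV t K N x z) (hφ : PhV t q φ) (hq : 0 ≤ q) (hqx : q ≤ x) (hx : x ≤ 0.6)
    (hs : (0.6 : ℝ) ^ (K / t) ≤ 0.1) (hN : 0 < N) :
    x - q ≤ 50 * q ^ (N + 1) + 30 * Zt N z ((K + 1) / t) := by
  have h1 := lhs_lower ht hz hφ hq hqx hx hs hN
  rw [pairing hz hφ] at h1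
  have h2 : ∑ s ∈ Finset.range N, z s * defect t K N q φ s ≤
      ∑ s ∈ Finset.range N, (z s * (5 * q ^ (N + 1)) + 3 * (if (K + 1) / t ≤ s then z s else 0)) := by
    apply Finset.sum_le_sum
    intro s _
    have h3 := mul_le_mul_of_nonneg_left (defect_upper (K := K) (N := N) hφ hq (hqx.trans hx) s) (hz.nonneg s)
    refine h3.trans (le_of_eq ?_)
    have : K + 1 < t * (s + 1) ↔ (K + 1) / t ≤ s := by
      rw [← Nat.lt_succ_iff, Nat.div_lt_iff_lt_mul (by omega), mul_comm]
    simp only [this]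
    split_ifs <;> ring
  rw [Finset.sum_add_distrib, ← Finset.sum_mul, hz.sum, ← Finset.mul_sum] at h2
  unfold Zt
  linarith

end

/-! ### Part J : final estimates -/

section
variable {t K N : ℕ} {x q : ℝ} {z φ : ℕ → ℝ}

lemma pow_rpow_eq (ht : 2 ≤ t) (hx : 0 < x) (m : ℕ) :
    x ^ m * x ^ ((m : ℝ) / ((t : ℝ) - 1)) = x ^ (((t * m : ℕ) : ℝ) / ((t : ℝ) - 1)) := by
  have hT : (0 : ℝ) < (t : ℝ) - 1 := by
    have : (2 : ℝ) ≤ t := by exact_mod_cast ht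
    linarith
  rw [← Real.rpow_natCast, ← Real.rpow_add hx]
  congr 1
  push_cast
  field_simp
  ring

lemma z_step (ht : 2 ≤ t) (hz : EigV t K N x z) (hx : 0 < x) (hK : t ≤ K + 1) (r : ℕ) (hr : r < N) :
    x ^ (r + 1) * z (r / t) ≤ z r := by
  rw [hz.eq r hr]
  apply mul_le_mul_of_nonneg_left _ (by positivity)
  have hd : r / t ≤ r := Nat.div_le_self r t
  have h := Finset.single_le_sum (f := fun s => if r + 1 ≤ t * (s + 1) ∧ t * (s + 1) ≤ r + 1 + K then z s else 0)
    (s := Finset.range N) (fun s _ => by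
      split_ifs
      · exact hz.nonneg s
      · exact le_rfl) (Finset.mem_range.mpr (show r / t < N by omega))
  refine le_trans (le_of_eq ?_) h
  rw [if_pos]
  have h1 := Nat.div_add_mod r t
  have h2 := Nat.mod_lt r (show 0 < t by omega)
  rw [mul_add, mul_one]
  omega

lemma z_lower (ht : 2 ≤ t) (hz : EigV t K N x z) (hx : 1 / 2 ≤ x) (hx1 : x ≤ 0.6) (hK : t ≤ K + 1) :
    ∀ r : ℕ, 1 ≤ r → r < N →
      z 0 * x * (x ^ r * x ^ ((r : ℝ) / ((t : ℝ) - 1))) / r ≤ z r := by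
  have ht' : (2 : ℝ) ≤ t := by exact_mod_cast ht
  have hT : (0 : ℝ) < (t : ℝ) - 1 := by linarith
  have hx0 : 0 < x := by linarith
  have hz0 := hz.nonneg 0
  intro r
  induction r using Nat.strong_induction_on with
  | _ r ih =>
    intro hr1 hrN
    have hr' : (1 : ℝ) ≤ r := by exact_mod_cast hr1
    have hstep := z_step ht hz hx0 hK r hrN
    refine le_trans ?_ hstep
    by_cases hrt : r < t
    · rw [Nat.div_eq_of_lt hrt]
      have h1 : x ^ ((r : ℝ) / ((t : ℝ) - 1)) ≤ 1 :=
        Real.rpow_le_one hx0.le (by linarith) (by positivity)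
      rw [div_le_iff₀ (by linarith)]
      have h2 : z 0 * x * (x ^ r * x ^ ((r : ℝ) / ((t : ℝ) - 1))) ≤ z 0 * x * (x ^ r * 1) := by
        gcongr
      have h3 : 0 ≤ x ^ (r + 1) * z 0 := by positivity
      have h4 : z 0 * x * (x ^ r * 1) = x ^ (r + 1) * z 0 := by rw [pow_succ]; ring
      nlinarith
    · push Not at hrt
      set m := r / t with hm
      have hm1 : 1 ≤ m := Nat.div_pos hrt (by omega)
      have hmr : m < r := Nat.div_lt_self (by omega) (by omega)
      have hmt : t * m ≤ r := Nat.mul_div_le r t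
      have hmt' : (t : ℝ) * m ≤ r := by exact_mod_cast hmt
      have hm' : (1 : ℝ) ≤ m := by exact_mod_cast hm1
      have h1 := ih m hmr hm1 (by omega)
      rw [pow_rpow_eq ht hx0] at h1
      have h2 : x ^ ((r : ℝ) / ((t : ℝ) - 1)) ≤ x ^ (((t * m : ℕ) : ℝ) / ((t : ℝ) - 1)) := by
        apply Real.rpow_le_rpow_of_exponent_ge hx0 (by linarith)
        gcongr
      have h3 : (1 : ℝ) / r ≤ x / m := by
        rw [div_le_div_iff₀ (by linarith) (by linarith)]
        nlinarith
      calc z 0 * x * (x ^ r * x ^ ((r : ℝ) / ((t : ℝ) - 1))) / r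
          = z 0 * x ^ (r + 1) * x ^ ((r : ℝ) / ((t : ℝ) - 1)) * (1 / r) := by rw [pow_succ]; ring
        _ ≤ z 0 * x ^ (r + 1) * x ^ (((t * m : ℕ) : ℝ) / ((t : ℝ) - 1)) * (x / m) := by
            exact mul_le_mul (by gcongr) h3 (by positivity) (by positivity)
        _ = x ^ (r + 1) * (z 0 * x * x ^ (((t * m : ℕ) : ℝ) / ((t : ℝ) - 1)) / m) := by ring
        _ ≤ _ := by gcongr

lemma Zt_step (ht : 2 ≤ t) (hz : EigV t K N x z) (hx0 : 0 < x) (hx1 : x ≤ 0.6) (m : ℕ) :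
    Zt N z m ≤ 1.5 * x ^ m * Zt N z (m / t) := by
  have hZ : 0 ≤ Zt N z (m / t) := by
    apply Finset.sum_nonneg
    intro s _
    split_ifs
    · exact hz.nonneg s
    · exact le_rfl
  have h1 : Zt N z m ≤ ∑ r ∈ Finset.range N, (if m ≤ r then x ^ (r + 1) else 0) * Zt N z (m / t) := by
    apply Finset.sum_le_sum
    intro r hr
    split_ifs with hmr
    · rw [hz.eq r (Finset.mem_range.mp hr)]
      apply mul_le_mul_of_nonneg_left _ (by positivity)
      apply Finset.sum_le_sum
      intro s _
      have := hz.nonneg s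
      split_ifs with a b b
      · exact le_rfl
      · exfalso
        apply b
        have : m / t < s + 1 := by
          rw [Nat.div_lt_iff_lt_mul (by omega), mul_comm]; omega
        omega
      · exact this
      · exact le_rfl
    · simp
  rw [← Finset.sum_mul] at h1
  refine h1.trans (mul_le_mul_of_nonneg_right ?_ hZ)
  refine (geom_ite_le hx0.le (by linarith) m N).trans ?_
  rw [div_le_iff₀ (by linarith), pow_succ]
  have : 0 < x ^ m := by positivity
  nlinarith

lemma Zt_le_one (hz : EigV t K N x z) (m : ℕ) : Zt N z m ≤ 1 := hz.inner_le _

lemma Zt_upper (ht : 2 ≤ t) (hz : EigV t K N x z) (hx : 1 / 2 ≤ x) (hx1 : x ≤ 0.6) :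
    ∀ m : ℕ, Zt N z m ≤ 1024 * ((m : ℝ) + 1) ^ 2 * (x ^ m * x ^ ((m : ℝ) / ((t : ℝ) - 1))) := by
  have ht' : (2 : ℝ) ≤ t := by exact_mod_cast ht
  have hT : (0 : ℝ) < (t : ℝ) - 1 := by linarith
  have hx0 : 0 < x := by linarith
  intro m
  induction m using Nat.strong_induction_on with
  | _ m ih =>
    by_cases hm : m ≤ 5
    · refine (Zt_le_one hz m).trans ?_
      have hmR : (m : ℝ) ≤ 5 := by exact_mod_cast hm
      have h1 : (1 / 2 : ℝ) ^ 5 ≤ x ^ m := by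
        calc (1 / 2 : ℝ) ^ 5 ≤ (1 / 2) ^ m := pow_le_pow_of_le_one (by norm_num) (by norm_num) hm
          _ ≤ x ^ m := by gcongr
      have h2 : (1 / 2 : ℝ) ^ 5 ≤ x ^ ((m : ℝ) / ((t : ℝ) - 1)) := by
        calc (1 / 2 : ℝ) ^ 5 ≤ x ^ 5 := by gcongr
          _ = x ^ ((5 : ℕ) : ℝ) := (Real.rpow_natCast _ _).symm
          _ ≤ _ := by
            apply Real.rpow_le_rpow_of_exponent_ge hx0 (by linarith)
            rw [div_le_iff₀ hT]
            have : (0 : ℝ) ≤ m := by positivity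
            push_cast
            nlinarith
      have h3 : (1 / 2 : ℝ) ^ 5 * (1 / 2) ^ 5 ≤ x ^ m * x ^ ((m : ℝ) / ((t : ℝ) - 1)) := by gcongr
      have h4 : (1 : ℝ) ≤ ((m : ℝ) + 1) ^ 2 := by
        have : (0 : ℝ) ≤ m := by positivity
        nlinarith
      calc (1 : ℝ) = 1024 * 1 * ((1 / 2 : ℝ) ^ 5 * (1 / 2) ^ 5) := by norm_num
        _ ≤ _ := by gcongr
    · push Not at hm
      set k := m / t with hk
      have hkm : k < m := Nat.div_lt_self (by omega) (by omega)
      have h1 := ih k hkm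
      rw [pow_rpow_eq ht hx0] at h1
      have h2 := Zt_step ht hz hx0 hx1 m
      have hk2 : 2 * k ≤ m := by
        have : t * k ≤ m := Nat.mul_div_le m t
        nlinarith
      have hk2' : 2 * (k : ℝ) ≤ m := by exact_mod_cast hk2
      have hkt : m + 1 ≤ t * k + t := by
        have a1 := Nat.div_add_mod m t
        have a2 := Nat.mod_lt m (show 0 < t by omega)
        rw [← hk] at a1
        omega
      have hkt' : (m : ℝ) + 1 ≤ ((t * k : ℕ) : ℝ) + t := by exact_mod_cast hkt
      have h3 : x ^ (((t * k : ℕ) : ℝ) / ((t : ℝ) - 1)) ≤ 2 * x ^ ((m : ℝ) / ((t : ℝ) - 1)) := by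
        have a1 : x ^ (((t * k : ℕ) : ℝ) / ((t : ℝ) - 1)) ≤ x ^ ((m : ℝ) / ((t : ℝ) - 1) - 1) := by
          apply Real.rpow_le_rpow_of_exponent_ge hx0 (by linarith)
          rw [sub_le_iff_le_add, div_add_one hT.ne']
          gcongr
          linarith
        rw [Real.rpow_sub_one hx0.ne', le_div_iff₀ hx0] at a1
        have a2 : 0 < x ^ (((t * k : ℕ) : ℝ) / ((t : ℝ) - 1)) := by positivity
        nlinarith
      have hm' : (6 : ℝ) ≤ m := by exact_mod_cast hm
      calc Zt N z m ≤ 1.5 * x ^ m * (1024 * ((k : ℝ) + 1) ^ 2 * (2 * x ^ ((m : ℝ) / ((t : ℝ) - 1)))) := by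
            refine h2.trans ?_
            gcongr
            refine h1.trans ?_
            gcongr
        _ = 1024 * (3 * ((k : ℝ) + 1) ^ 2) * (x ^ m * x ^ ((m : ℝ) / ((t : ℝ) - 1))) := by ring
        _ ≤ _ := by
            gcongr
            have : ((k : ℝ) + 1) ^ 2 ≤ ((m : ℝ) / 2 + 1) ^ 2 := by
              gcongr
              linarith
            nlinarith

lemma NK_succ (ht : 2 ≤ t) (hK : 1 ≤ K) : (K : ℝ) / ((t : ℝ) - 1) ≤ ((NK t K + 1 : ℕ) : ℝ) := by
  have ht' : (2 : ℝ) ≤ t := by exact_mod_cast ht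
  rw [div_le_iff₀ (by linarith)]
  have h : K ≤ (NK t K + 1) * (t - 1) := by
    unfold NK
    obtain ⟨u, rfl⟩ : ∃ u, t = u + 2 := ⟨t - 2, by omega⟩
    simp only [show u + 2 - 1 = u + 1 by omega, show K + (u + 2) - 2 = K + u by omega]
    have h1 : 1 ≤ (K + u) / (u + 1) := by
      rw [Nat.le_div_iff_mul_le (by omega)]; omega
    rw [Nat.sub_add_cancel h1]
    have h2 := Nat.div_add_mod (K + u) (u + 1)
    have h3 := Nat.mod_lt (K + u) (show 0 < u + 1 by omega)
    rw [mul_comm]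
    omega
  have h2 : ((K : ℕ) : ℝ) ≤ (((NK t K + 1) * (t - 1) : ℕ) : ℝ) := by exact_mod_cast h
  rw [Nat.cast_mul, Nat.cast_sub (by omega)] at h2
  simpa using h2

/-- the lower bound -/
lemma final_lower (ht : 2 ≤ t) (hK : t ^ 2 + t ≤ K) (hz : EigV t K (NK t K) x z) (hφ : PhV t q φ)
    (hq : 1 / 2 ≤ q) (hqx : q ≤ x) (hx : x ≤ 0.6) (hs : (0.6 : ℝ) ^ (K / t) ≤ 0.1) :
    q + 0.0005 / K * q ^ ((K : ℝ) / ((t : ℝ) - 1)) ≤ x := by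
  have ht' : (2 : ℝ) ≤ t := by exact_mod_cast ht
  have hT : (0 : ℝ) < (t : ℝ) - 1 := by linarith
  have hq0 : 0 < q := by linarith
  have hx0 : 0 < x := by linarith
  set s := (K + 1) / t with hsdef
  have hst : t * s ≤ K + 1 := Nat.mul_div_le _ _
  have hst2 : K + 1 < t * (s + 1) := by
    have a1 := Nat.div_add_mod (K + 1) t
    have a2 := Nat.mod_lt (K + 1) (show 0 < t by omega)
    rw [← hsdef] at a1
    rw [mul_add]; omega
  have hsge : t + 1 ≤ s := by
    rw [hsdef, Nat.le_div_iff_mul_le (by omega)]; nlinarith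
  have hsN : s < NK t K := by
    unfold NK
    have : s + 2 ≤ (K + t - 2) / (t - 1) := by
      rw [Nat.le_div_iff_mul_le (by omega)]
      obtain ⟨u, rfl⟩ : ∃ u, t = u + 2 := ⟨t - 2, by omega⟩
      simp only [show u + 2 - 1 = u + 1 by omega, show K + (u + 2) - 2 = K + u by omega]
      nlinarith
    omega
  have hK6 : 6 ≤ K := by nlinarith
  have hsK : s ≤ K := by nlinarith
  have h1 := diff_lower hz hφ hq hqx hx s hsN hst2
  have h2 := z_lower ht hz (hq.trans hqx) hx (by nlinarith) s (by omega) hsN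
  rw [pow_rpow_eq ht hx0] at h2
  have hz0 : 1 / 4 ≤ z 0 := by
    have : z 0 = x ^ (0 + 1) * Sz t K (NK t K) z 0 := hz.eq 0 (by omega)
    rw [this]
    have := Sz_zero_ge ht hz hx0.le hx hs
    rw [zero_add, pow_one]
    nlinarith
  have h3 : (1 / 2) * q ^ ((K : ℝ) / ((t : ℝ) - 1)) ≤ x ^ (((t * s : ℕ) : ℝ) / ((t : ℝ) - 1)) := by
    calc (1 / 2) * q ^ ((K : ℝ) / ((t : ℝ) - 1)) ≤ q * q ^ ((K : ℝ) / ((t : ℝ) - 1)) := by gcongr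
      _ = q ^ ((K : ℝ) / ((t : ℝ) - 1) + 1) := by rw [Real.rpow_add_one hq0.ne', mul_comm]
      _ ≤ q ^ (((t * s : ℕ) : ℝ) / ((t : ℝ) - 1)) := by
          apply Real.rpow_le_rpow_of_exponent_ge hq0 (by linarith)
          rw [div_add_one hT.ne']
          gcongr
          have : ((t * s : ℕ) : ℝ) ≤ K + 1 := by exact_mod_cast hst
          linarith
      _ ≤ _ := Real.rpow_le_rpow hq0.le hqx (by positivity)
  have hKp : (0 : ℝ) < K := by exact_mod_cast (show 0 < K by omega)
  have hsp : (0 : ℝ) < s := by exact_mod_cast (show 0 < s by omega)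
  have hsK' : (s : ℝ) ≤ K := by exact_mod_cast hsK
  have h4 : (1 / 4) * (1 / 2) * ((1 / 2) * q ^ ((K : ℝ) / ((t : ℝ) - 1))) / K ≤ z s := by
    refine le_trans ?_ h2
    have : (1 : ℝ) / 2 ≤ x := hq.trans hqx
    have h0 : 0 ≤ z 0 := hz.nonneg 0
    gcongr
  have h5 : 0.0005 / K * q ^ ((K : ℝ) / ((t : ℝ) - 1)) =
      0.008 * ((1 / 4) * (1 / 2) * ((1 / 2) * q ^ ((K : ℝ) / ((t : ℝ) - 1))) / K) := by ring
  rw [h5]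
  have h6 := mul_le_mul_of_nonneg_left h4 (show (0 : ℝ) ≤ 0.008 by norm_num)
  linarith

/-- the upper bound -/
lemma final_upper (ht : 2 ≤ t) (hK : 1 ≤ K) (hN : 0 < NK t K) (hz : EigV t K (NK t K) x z) (hφ : PhV t q φ)
    (hq : 1 / 2 ≤ q) (hqx : q ≤ x) (hx : x ≤ 0.6) (hs : (0.6 : ℝ) ^ (K / t) ≤ 0.1)
    (hbig : 250000 * (K : ℝ) ^ 3 * 0.6 ^ ((K : ℝ) / ((t : ℝ) - 1)) ≤ 1 / 2) :
    x ≤ q + 2000000 * K ^ 2 * q ^ ((K : ℝ) / ((t : ℝ) - 1)) := by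
  have ht' : (2 : ℝ) ≤ t := by exact_mod_cast ht
  have hT : (0 : ℝ) < (t : ℝ) - 1 := by linarith
  have hq0 : 0 < q := by linarith
  have hx0 : 0 < x := by linarith
  have hK' : (1 : ℝ) ≤ K := by exact_mod_cast hK
  have h1 := diff_upper ht hz hφ hq0.le hqx hx hs hN
  set m := (K + 1) / t with hm
  have h2 := Zt_upper ht hz (hq.trans hqx) hx m
  rw [pow_rpow_eq ht hx0] at h2
  set κ : ℝ := (K : ℝ) / ((t : ℝ) - 1) with hκ
  have hκ0 : 0 ≤ κ := by positivity
  have hκK : κ ≤ K := by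
    rw [hκ, div_le_iff₀ hT]
    nlinarith
  have h3 : x ^ (((t * m : ℕ) : ℝ) / ((t : ℝ) - 1)) ≤ 2 * x ^ κ := by
    have a0 : K + 2 ≤ t * m + t := by
      have a1 := Nat.div_add_mod (K + 1) t
      have a2 := Nat.mod_lt (K + 1) (show 0 < t by omega)
      rw [← hm] at a1
      omega
    have a0' : (K : ℝ) + 2 ≤ ((t * m : ℕ) : ℝ) + t := by exact_mod_cast a0
    have a1 : x ^ (((t * m : ℕ) : ℝ) / ((t : ℝ) - 1)) ≤ x ^ (κ - 1) := by
      apply Real.rpow_le_rpow_of_exponent_ge hx0 (by linarith)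
      rw [sub_le_iff_le_add, div_add_one hT.ne', hκ]
      apply div_le_div_of_nonneg_right _ hT.le
      linarith
    rw [Real.rpow_sub_one hx0.ne', le_div_iff₀ hx0] at a1
    have a2 : 0 < x ^ (((t * m : ℕ) : ℝ) / ((t : ℝ) - 1)) := by positivity
    nlinarith
  have hm2 : (m : ℝ) + 1 ≤ 2 * K := by
    have : t * m ≤ K + 1 := Nat.mul_div_le _ _
    have : m + 1 ≤ 2 * K := by nlinarith
    exact_mod_cast this
  have h4 : Zt (NK t K) z m ≤ 8192 * K ^ 2 * x ^ κ := by
    calc _ ≤ 1024 * (2 * (K : ℝ)) ^ 2 * (2 * x ^ κ) := by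
          refine h2.trans ?_
          gcongr
      _ = _ := by ring
  have h5 : q ^ (NK t K + 1) ≤ q ^ κ := by
    rw [← Real.rpow_natCast]
    exact Real.rpow_le_rpow_of_exponent_ge hq0 (by linarith) (NK_succ ht hK)
  have h6 : x - q ≤ 50 * q ^ κ + 245760 * K ^ 2 * x ^ κ := by linarith
  have hqκ : q ^ κ ≤ x ^ κ := Real.rpow_le_rpow hq0.le hqx hκ0
  have hxκ : x ^ κ ≤ 0.6 ^ κ := Real.rpow_le_rpow hx0.le hx hκ0
  have hK2 : (1 : ℝ) ≤ (K : ℝ) ^ 2 := one_le_pow₀ hK'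
  have hxp : 0 < x ^ κ := by positivity
  have hqp : 0 < q ^ κ := by positivity
  have h7 : x - q ≤ 250000 * K ^ 2 * 0.6 ^ κ := by
    calc x - q ≤ 50 * x ^ κ + 245760 * K ^ 2 * x ^ κ := by linarith
      _ ≤ 250000 * K ^ 2 * x ^ κ := by nlinarith
      _ ≤ _ := by gcongr
  have h8 : κ * (x - q) ≤ 1 / 2 := by
    calc κ * (x - q) ≤ K * (250000 * K ^ 2 * 0.6 ^ κ) := by
          have : 0 ≤ x - q := by linarith
          gcongr
      _ = 250000 * (K : ℝ) ^ 3 * 0.6 ^ κ := by ring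
      _ ≤ _ := hbig
  have h9 : x ^ κ ≤ 3 * q ^ κ := by
    have a1 : x ≤ q * Real.exp (2 * (x - q)) := by
      have := Real.add_one_le_exp (2 * (x - q))
      nlinarith
    calc x ^ κ ≤ (q * Real.exp (2 * (x - q))) ^ κ := Real.rpow_le_rpow hx0.le a1 hκ0
      _ = q ^ κ * Real.exp (2 * (x - q) * κ) := by
          rw [Real.mul_rpow hq0.le (Real.exp_pos _).le, ← Real.exp_mul]
      _ ≤ q ^ κ * Real.exp 1 := by
          gcongr
          linarith
      _ ≤ q ^ κ * 3 := by
          have := Real.exp_one_lt_d9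
          gcongr
          linarith
      _ = _ := by ring
  have h10 : 245760 * (K : ℝ) ^ 2 * x ^ κ ≤ 245760 * (K : ℝ) ^ 2 * (3 * q ^ κ) := by gcongr
  nlinarith

end

lemma hbig_eventually {t : ℕ} (ht : 2 ≤ t) : ∀ᶠ K : ℕ in atTop,
    250000 * (K : ℝ) ^ 3 * 0.6 ^ ((K : ℝ) / ((t : ℝ) - 1)) ≤ 1 / 2 := by
  have ht' : (2 : ℝ) ≤ t := by exact_mod_cast ht
  have hT : (0 : ℝ) < (t : ℝ) - 1 := by linarith
  set ρ : ℝ := 0.6 ^ (1 / ((t : ℝ) - 1)) with hρ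
  have hρ0 : 0 < ρ := by positivity
  have hρ1 : ρ < 1 := Real.rpow_lt_one (by norm_num) (by norm_num) (by positivity)
  have h := tendsto_pow_const_mul_const_pow_of_abs_lt_one 3 (r := ρ) (by rw [abs_of_pos hρ0]; exact hρ1)
  filter_upwards [h.eventually (gt_mem_nhds (show (0 : ℝ) < 1 / 500000 by norm_num))] with K hK
  have : (0.6 : ℝ) ^ ((K : ℝ) / ((t : ℝ) - 1)) = ρ ^ K := by
    rw [hρ, ← Real.rpow_natCast, ← Real.rpow_mul (by norm_num)]
    congr 1
    ring
  rw [this]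
  linarith

theorem main_aux (t : ℕ) (ht : 2 ≤ t)
    (q₀ : ℝ) (hq₀pos : 0 < q₀) (hq₀lt : q₀ < 1 - 0.72 / t)
    (hq₀root : bGF t (q₀ : ℂ) 1 1 1 = 1)
    (hq₀uniq : ∀ q : ℂ, ‖q‖ < 1 - 0.72 / t → bGF t q 1 1 1 = 1 → q = (q₀ : ℂ)) :
    ∃ c₅ c₆ c₇ : ℝ, 0 < c₅ ∧ 0 < c₆ ∧ 0 < c₇ ∧
      ∀ K : ℕ, c₇ ≤ K →
        ∃ qK : ℝ,
          q₀ + c₅ / K * q₀ ^ ((K : ℝ) / ((t : ℝ) - 1)) ≤ qK ∧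
          qK ≤ q₀ + c₆ * K ^ 2 * q₀ ^ ((K : ℝ) / ((t : ℝ) - 1)) ∧
          detIminusMK t K (qK : ℂ) = 0 ∧
          ∃ g : ℂ → ℂ,
            AnalyticOnNhd ℂ g (Metric.closedBall (0 : ℂ) 0.6) ∧
            g (qK : ℂ) ≠ 0 ∧
            ∀ q : ℂ, ‖q‖ < qK →
              HasSum
                (fun T : {T : CanonicalForest t 1 // T.width ≤ K} =>
                  q ^ (T : CanonicalForest t 1).size)
                (g q / ((qK : ℂ) - q)) := by
  have hm := q0_mem ht q₀ hq₀uniq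
  have hrad : (0.61 : ℝ) < 1 - 0.72 / t := by
    have ht' : (2 : ℝ) ≤ t := by exact_mod_cast ht
    have : (0.72 : ℝ) / t ≤ 0.72 / 2 := by gcongr
    norm_num at this ⊢
    linarith
  have hq0n : ‖(q₀ : ℂ)‖ ≤ 0.61 := by
    rw [Complex.norm_real, Real.norm_eq_abs, abs_of_pos hq₀pos]; linarith [hm.2]
  have hroot : ph t q₀ 0 = 0 := by
    have := bGF_eq ht hq0n
    rw [hq₀root] at this
    linear_combination this
  have huniq : ∀ q : ℂ, ‖q‖ < 0.61 → ph t q 0 = 0 → q = q₀ := by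
    intro q hq h0
    apply hq₀uniq q (by linarith)
    rw [bGF_eq ht hq.le, h0, sub_zero]
  have hφ := phV_exists ht hq₀pos hm.2.le hroot
  set δ := min ((0.6 - q₀) / 2) (q₀ / 2) with hδ
  have hδ0 : 0 < δ := lt_min (by linarith [hm.2]) (by linarith)
  have hev := exists_qK ht hm hroot huniq δ hδ0
  have heps : ∀ᶠ K in atTop, epsK t K ≤ 0.00005 :=
    ((epsK_tendsto ht).eventually (gt_mem_nhds (by norm_num))).mono (fun _ h => h.le)
  obtain ⟨K0, hK0⟩ := eventually_atTop.mp
    (hev.and (heps.and ((hbig_eventually ht).and (eventually_ge_atTop (t ^ 2 + t)))))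
  refine ⟨0.0005, 2000000, (K0 : ℝ) + 1, by norm_num, by norm_num, by positivity, ?_⟩
  intro K hK
  have hK' : K0 ≤ K := by
    have : (K0 : ℝ) ≤ K := by linarith
    exact_mod_cast this
  obtain ⟨⟨x, hx1, hx2, hx3, hx4⟩, he, hbig, hKt⟩ := hK0 K hK'
  have hx1' := abs_le.mp hx1
  have hd1 : δ ≤ (0.6 - q₀) / 2 := min_le_left _ _
  have hd2 : δ ≤ q₀ / 2 := min_le_right _ _
  have hxlt : x < 0.6 := by linarith [hm.2]
  have hx0 : 0 < x := by linarith
  have hK1 : 1 ≤ K := by nlinarith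
  have he' : epsK t K ≤ 0.05 := he.trans (by norm_num)
  have hs : (0.6 : ℝ) ^ (K / t) ≤ 0.1 := by
    have : (0.6 : ℝ) ^ (K / t) ≤ epsK t K := by
      unfold epsK; gcongr; norm_num
    refine this.trans (he'.trans (by norm_num))
  have hN : 0 < NK t K := by
    have h1 := NK_ge (t := t) ht hK1
    have : 2 ≤ K / t := by
      rw [Nat.le_div_iff_mul_le (by omega)]; nlinarith
    omega
  have hxn : ‖(x : ℂ)‖ ≤ 0.61 := by
    rw [Complex.norm_real, Real.norm_eq_abs, abs_of_pos hx0]; linarith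
  obtain ⟨z, hz, hzs⟩ := eigV_exists (N := NK t K) ht he' hx0 (by linarith)
    (fun y h0 h1 h2 => by
      have := hx4 y (by rw [Complex.norm_real, Real.norm_eq_abs, abs_of_nonneg h0]; linarith) h2
      have : y = x := by exact_mod_cast this
      linarith) hx2
  have hqx := qK_ge ht hz hφ hx0 hxlt.le hs hN hq₀pos
  refine ⟨x, ?_, ?_, ?_, ?_⟩
  · exact final_lower ht hKt hz hφ hm.1.le hqx hxlt.le hs
  · exact final_upper ht hK1 hN hz hφ hm.1.le hqx hxlt.le hs hbig
  · exact AM_det_zero ht he' hxn hx2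
  · exact pole_form ht he hK1 hN hx0 hxlt hx2 hx3 hx4 hz hzs

/-- For `K` large enough, the generating function
`W_K(q) = Σ_{w(T) ≤ K} q^{n(T)}` of canonical `t`-ary trees of width at most `K` has a
unique singularity `q_K` with `|q_K| ≤ 0.6`; it is a simple pole (expressed below by the
meromorphic representation `W_K(q) = g(q)/(q_K − q)` with `g` analytic on the disc and
`g(q_K) ≠ 0`) and a zero of `det(I − M_K(q))`; moreover
`q₀ + (c₅/K)·q₀^{K/(t−1)} ≤ q_K ≤ q₀ + c₆·K²·q₀^{K/(t−1)}`. -/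
theorem restricted_width_singularity (t : ℕ) (ht : 2 ≤ t)
    (q₀ : ℝ) (hq₀pos : 0 < q₀) (hq₀lt : q₀ < 1 - 0.72 / t)
    (hq₀root : bGF t (q₀ : ℂ) 1 1 1 = 1)
    (hq₀uniq : ∀ q : ℂ, ‖q‖ < 1 - 0.72 / t → bGF t q 1 1 1 = 1 → q = (q₀ : ℂ)) :
    ∃ c₅ c₆ c₇ : ℝ, 0 < c₅ ∧ 0 < c₆ ∧ 0 < c₇ ∧
      ∀ K : ℕ, c₇ ≤ K →
        ∃ qK : ℝ,
          q₀ + c₅ / K * q₀ ^ ((K : ℝ) / ((t : ℝ) - 1)) ≤ qK ∧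
          qK ≤ q₀ + c₆ * K ^ 2 * q₀ ^ ((K : ℝ) / ((t : ℝ) - 1)) ∧
          detIminusMK t K (qK : ℂ) = 0 ∧
          ∃ g : ℂ → ℂ,
            AnalyticOnNhd ℂ g (Metric.closedBall (0 : ℂ) 0.6) ∧
            g (qK : ℂ) ≠ 0 ∧
            ∀ q : ℂ, ‖q‖ < qK →
              HasSum
                (fun T : {T : CanonicalForest t 1 // T.width ≤ K} =>
                  q ^ (T : CanonicalForest t 1).size)
                (g q / ((qK : ℂ) - q)) := by
  exact main_aux t ht q₀ hq₀pos hq₀lt hq₀root hq₀uniq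

end
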